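/- arXiv:1204.4943 — 14 statements merged into one kernel-verified Lean document; each statement's English description precedes it below -/
import Mathlib

section
/- For each fixed real number λ > 0, the function t ↦ sinh t · ( sinh(2t)/√(sinh(2t)² − sinh(2λ)²) − 1 ) is integrable on the interval (λ, ∞); in particular the quantity f(λ) = ∫_λ^∞ sinh t · ( sinh(2t)/√(sinh(2t)² − sinh(2λ)²) − 1 ) dt is a well-defined finite real number. -/
open Real MeasureTheory

theorem catenoid_f_integrable (l : ℝ) (hl : 0 < l) :
    IntegrableOn
      (fun t : ℝ => Real.sinh t *
        (Real.sinh (2 * t) / Real.sqrt ((Real.sinh (2 * t)) ^ 2 - (Real.sinh (2 * l)) ^ 2) - 1))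
      (Set.Ioi l) := by
  set A := Real.sinh (2 * l) with hA
  have hA0 : 0 < A := Real.sinh_pos_iff.2 (by linarith)
  have hS : ∀ t ∈ Set.Ioi l, A < Real.sinh (2 * t) := fun t ht =>
    Real.sinh_lt_sinh.2 (by have : l < t := ht; linarith)
  have hD : ∀ t ∈ Set.Ioi l, 0 < (Real.sinh (2 * t)) ^ 2 - A ^ 2 := fun t ht => by
    have := hS t ht
    nlinarith
  have key : IntegrableOn (fun t : ℝ => A ^ 2 * (2 * Real.cosh (2 * t)) /
      (Real.sinh (2 * t) * Real.sqrt ((Real.sinh (2 * t)) ^ 2 - A ^ 2))) (Set.Ioi l) := by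
    refine integrableOn_Ioi_deriv_of_nonneg
      (g := fun t => A * Real.arctan (Real.sqrt ((Real.sinh (2 * t)) ^ 2 - A ^ 2) / A))
      (l := A * (π / 2)) ?_ ?_ ?_ ?_
    · apply Continuous.continuousWithinAt
      have h1 : Continuous fun t : ℝ => Real.sqrt ((Real.sinh (2 * t)) ^ 2 - A ^ 2) / A := by
        have : Continuous fun t : ℝ => Real.sinh (2 * t) :=
          Real.continuous_sinh.comp (by fun_prop)
        exact ((this.pow 2).sub continuous_const).sqrt.div_const _
      exact continuous_const.mul (Real.continuous_arctan.comp h1)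
    · intro t ht
      have hd := hD t ht
      have hs := hS t ht
      have h2 : HasDerivAt (fun t : ℝ => 2 * t) 2 t := by
        simpa using (hasDerivAt_id t).const_mul 2
      have h3 := ((((h2.sinh.pow 2).sub_const (A ^ 2)).sqrt hd.ne').div_const A).arctan.const_mul A
      refine h3.congr_deriv ?_
      have hq := Real.sqrt_pos.2 hd
      have hs0 : 0 < Real.sinh (2 * t) := hA0.trans hs
      have e : 1 + (Real.sqrt ((Real.sinh (2 * t)) ^ 2 - A ^ 2) / A) ^ 2
          = Real.sinh (2 * t) ^ 2 / A ^ 2 := by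
        rw [div_pow, Real.sq_sqrt hd.le]
        field_simp
        ring
      simp only [Pi.pow_apply]
      rw [e]
      field_simp
      try norm_num
      try ring
    · intro t ht
      have hs0 : 0 < Real.sinh (2 * t) := hA0.trans (hS t ht)
      have := Real.cosh_pos (2 * t)
      positivity
    · refine Filter.Tendsto.const_mul A ?_
      refine (Real.tendsto_arctan_atTop.mono_right nhdsWithin_le_nhds).comp ?_
      refine Filter.Tendsto.atTop_div_const hA0 ?_
      refine Real.tendsto_sqrt_atTop.comp ?_
      refine Filter.tendsto_atTop_add_const_right _ _ ?_
      refine (Filter.tendsto_pow_atTop two_ne_zero).comp ?_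
      refine Filter.tendsto_atTop_mono' _ ?_ Filter.tendsto_id
      filter_upwards [Filter.eventually_ge_atTop 0] with t ht
      have : 2 * t ≤ Real.sinh (2 * t) := Real.self_le_sinh_iff.2 (by linarith)
      simp only [id]
      linarith
  refine Integrable.mono' key ?_ ?_
  · apply Measurable.aestronglyMeasurable
    have : Measurable fun t : ℝ => Real.sinh (2 * t) :=
      Real.measurable_sinh.comp (by fun_prop)
    exact Real.measurable_sinh.mul
      ((this.div (((this.pow_const 2).sub_const _).sqrt)).sub_const 1)
  · refine (ae_restrict_iff' measurableSet_Ioi).2 (Filter.Eventually.of_forall fun t ht => ?_)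
    have hd := hD t ht
    have hs := hS t ht
    have hs0 : 0 < Real.sinh (2 * t) := hA0.trans hs
    have ht0 : 0 < t := hl.trans ht
    have hst : 0 < Real.sinh t := Real.sinh_pos_iff.2 ht0
    have hc : Real.sinh t ≤ 2 * Real.cosh (2 * t) := by
      have h1 : Real.sinh t < Real.sinh (2 * t) := Real.sinh_lt_sinh.2 (by linarith)
      have h2 := Real.sinh_lt_cosh (2 * t)
      have h3 := Real.cosh_pos (2 * t)
      linarith
    have hq := Real.sqrt_pos.2 hd
    have hqq := Real.sq_sqrt hd.le
    generalize Real.sqrt ((Real.sinh (2 * t)) ^ 2 - A ^ 2) = q at *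
    generalize Real.sinh (2 * t) = S at *
    generalize Real.cosh (2 * t) = C at *
    have hqS : q ≤ S := by nlinarith
    have h1 : 0 ≤ S / q - 1 := by
      rw [sub_nonneg, le_div_iff₀ hq]; linarith
    have h2 : S / q - 1 ≤ A ^ 2 / (S * q) := by
      rw [div_sub_one hq.ne', div_le_div_iff₀ hq (by positivity)]
      have : (S - q) * S ≤ A ^ 2 := by nlinarith
      nlinarith
    rw [Real.norm_of_nonneg (mul_nonneg hst.le h1)]
    calc _ ≤ (2 * C) * (A ^ 2 / (S * q)) := mul_le_mul hc h2 h1 (hst.le.trans hc)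
      _ = _ := by ring
end

section
/- For each fixed t > 0, the function λ ↦ sinh(2t+2λ)/√(sinh(2t+2λ)² − sinh(2λ)²) is monotone increasing on [0, ∞). -/
open Real

theorem Theta_monotone_in_lambda (t : ℝ) (ht : 0 < t) :
    MonotoneOn
      (fun l : ℝ => Real.sinh (2 * t + 2 * l) /
        Real.sqrt ((Real.sinh (2 * t + 2 * l)) ^ 2 - (Real.sinh (2 * l)) ^ 2))
      (Set.Ici 0) := by
  intro a ha b hb hab
  simp only [Set.mem_Ici] at ha hb
  have key : sinh (2 * t + 2 * b) * sinh (2 * a) ≤ sinh (2 * t + 2 * a) * sinh (2 * b) := by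
    have h1 : 0 ≤ sinh (2 * t) := Real.sinh_nonneg_iff.2 (by linarith)
    have h2 : 0 ≤ sinh (2 * b - 2 * a) := Real.sinh_nonneg_iff.2 (by linarith)
    rw [Real.sinh_sub] at h2
    rw [Real.sinh_add, Real.sinh_add]
    nlinarith [mul_nonneg h1 h2]
  have hx : 0 ≤ sinh (2 * a) := Real.sinh_nonneg_iff.2 (by linarith)
  have hy : 0 ≤ sinh (2 * b) := Real.sinh_nonneg_iff.2 (by linarith)
  have hA : sinh (2 * a) < sinh (2 * t + 2 * a) := Real.sinh_lt_sinh.2 (by linarith)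
  have hB : sinh (2 * b) < sinh (2 * t + 2 * b) := Real.sinh_lt_sinh.2 (by linarith)
  dsimp only
  generalize sinh (2 * a) = x at *
  generalize sinh (2 * b) = y at *
  generalize sinh (2 * t + 2 * a) = A at *
  generalize sinh (2 * t + 2 * b) = B at *
  have hP : 0 < A ^ 2 - x ^ 2 := by nlinarith
  have hQ : 0 < B ^ 2 - y ^ 2 := by nlinarith
  rw [div_le_div_iff₀ (Real.sqrt_pos.2 hP) (Real.sqrt_pos.2 hQ)]
  have hA0 : 0 ≤ A := by linarith
  have hB0 : 0 ≤ B := by linarith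
  refine (pow_le_pow_iff_left₀ (by positivity) (by positivity) two_ne_zero).1 ?_
  rw [mul_pow, mul_pow, Real.sq_sqrt hP.le, Real.sq_sqrt hQ.le]
  have := pow_le_pow_left₀ (mul_nonneg hB0 hx) key 2
  nlinarith
end

section
/- For every t > 0 and every λ ≥ 0, one has sinh(2t+2λ)/√(sinh(2t+2λ)² − sinh(2λ)²) ≤ 1/√(1 − e^{−4t}), and the right-hand side equals the limit of the left-hand side as λ → ∞. -/
open Real Filter

lemma ratio_aux (t l : ℝ) (ht : 0 < t) (hl : 0 ≤ l) :
    Real.sinh (2 * l) / Real.sinh (2 * t + 2 * l) =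
      Real.exp (-(2 * t)) * (1 - Real.exp (-(4 * l))) /
        (1 - Real.exp (-(4 * t)) * Real.exp (-(4 * l))) := by
  have hS : 0 < Real.sinh (2 * t + 2 * l) := Real.sinh_pos_iff.2 (by linarith)
  have hd : 0 < 1 - Real.exp (-(4 * t)) * Real.exp (-(4 * l)) := by
    rw [← Real.exp_add]
    have : Real.exp (-(4 * t) + -(4 * l)) < 1 := Real.exp_lt_one_iff.2 (by linarith)
    linarith
  rw [div_eq_div_iff hS.ne' hd.ne', Real.sinh_eq, Real.sinh_eq]
  simp only [mul_sub, sub_mul, sub_div, mul_one, one_mul, div_mul_eq_mul_div, ← mul_div_assoc,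
    ← Real.exp_add]
  ring_nf

lemma Theta_aux (t l : ℝ) (ht : 0 < t) (hl : 0 ≤ l) :
    Real.sinh (2 * t + 2 * l) /
          Real.sqrt ((Real.sinh (2 * t + 2 * l)) ^ 2 - (Real.sinh (2 * l)) ^ 2)
      = 1 / Real.sqrt (1 - (Real.sinh (2 * l) / Real.sinh (2 * t + 2 * l)) ^ 2) := by
  have hS : 0 < Real.sinh (2 * t + 2 * l) := Real.sinh_pos_iff.2 (by linarith)
  have h : (Real.sinh (2 * t + 2 * l)) ^ 2 - (Real.sinh (2 * l)) ^ 2 =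
      (Real.sinh (2 * t + 2 * l)) ^ 2 *
        (1 - (Real.sinh (2 * l) / Real.sinh (2 * t + 2 * l)) ^ 2) := by
    field_simp
  rw [h, Real.sqrt_mul (sq_nonneg _), Real.sqrt_sq hS.le, div_mul_eq_div_div, div_self hS.ne']

theorem Theta_le_limit (t : ℝ) (ht : 0 < t) :
    (∀ l : ℝ, 0 ≤ l →
      Real.sinh (2 * t + 2 * l) /
          Real.sqrt ((Real.sinh (2 * t + 2 * l)) ^ 2 - (Real.sinh (2 * l)) ^ 2)
        ≤ 1 / Real.sqrt (1 - Real.exp (-(4 * t)))) ∧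
    Tendsto
      (fun l : ℝ => Real.sinh (2 * t + 2 * l) /
        Real.sqrt ((Real.sinh (2 * t + 2 * l)) ^ 2 - (Real.sinh (2 * l)) ^ 2))
      atTop (nhds (1 / Real.sqrt (1 - Real.exp (-(4 * t))))) := by
  have ha : Real.exp (-(4 * t)) = Real.exp (-(2 * t)) ^ 2 := by
    rw [← Real.exp_nat_mul]; push_cast; ring_nf
  have h1 : Real.exp (-(4 * t)) < 1 := Real.exp_lt_one_iff.2 (by linarith)
  have hpos : 0 < Real.sqrt (1 - Real.exp (-(4 * t))) := Real.sqrt_pos.2 (by linarith)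
  constructor
  · intro l hl
    rw [Theta_aux t l ht hl, ratio_aux t l ht hl]
    apply one_div_le_one_div_of_le hpos
    apply Real.sqrt_le_sqrt
    have hu : Real.exp (-(4 * l)) ≤ 1 := Real.exp_le_one_iff.2 (by linarith)
    have hu0 := Real.exp_pos (-(4 * l))
    have hd : 0 < 1 - Real.exp (-(4 * t)) * Real.exp (-(4 * l)) := by nlinarith
    have hle : Real.exp (-(2 * t)) * (1 - Real.exp (-(4 * l))) /
        (1 - Real.exp (-(4 * t)) * Real.exp (-(4 * l))) ≤ Real.exp (-(2 * t)) := by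
      rw [div_le_iff₀ hd]
      apply mul_le_mul_of_nonneg_left _ (Real.exp_pos _).le
      nlinarith
    have h0 : 0 ≤ Real.exp (-(2 * t)) * (1 - Real.exp (-(4 * l))) /
        (1 - Real.exp (-(4 * t)) * Real.exp (-(4 * l))) :=
      div_nonneg (mul_nonneg (Real.exp_pos _).le (by linarith)) hd.le
    have := pow_le_pow_left₀ h0 hle 2
    linarith
  · have hu : Tendsto (fun l : ℝ => Real.exp (-(4 * l))) atTop (nhds 0) :=
      Real.tendsto_exp_neg_atTop_nhds_zero.comp
        (tendsto_id.const_mul_atTop (by norm_num : (0 : ℝ) < 4))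
    have hr : Tendsto (fun l : ℝ => Real.exp (-(2 * t)) * (1 - Real.exp (-(4 * l))) /
        (1 - Real.exp (-(4 * t)) * Real.exp (-(4 * l)))) atTop (nhds (Real.exp (-(2 * t)))) := by
      have := ((hu.const_sub 1).const_mul (Real.exp (-(2 * t)))).div
        ((hu.const_mul (Real.exp (-(4 * t)))).const_sub 1) (by norm_num)
      simpa [Pi.div_def] using this
    have hf := (tendsto_const_nhds (x := (1 : ℝ))).div ((hr.pow 2).const_sub 1).sqrt
      (by rw [← ha]; exact hpos.ne')
    rw [← ha] at hf
    refine hf.congr' ?_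
    filter_upwards [eventually_ge_atTop 0] with l hl
    rw [Theta_aux t l ht hl, ratio_aux t l ht hl]
    rfl
end

section
/- The constant K = ∫_0^1 (1/x²) · ( 1/√(1−x⁴) − 1 ) dx satisfies 0 < K < 1. -/
open Real MeasureTheory

lemma K_aux_bound (x : ℝ) (h0 : 0 < x) (h1 : x < 1) :
    0 < (1 / x ^ 2) * (1 / Real.sqrt (1 - x ^ 4) - 1) ∧
    (1 / x ^ 2) * (1 / Real.sqrt (1 - x ^ 4) - 1) ≤ 3 / 4 * (x / Real.sqrt (1 - x ^ 2)) := by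
  have hx2 : x ^ 2 < 1 := by nlinarith
  have e : 1 - x ^ 4 = (1 - x ^ 2) * (1 + x ^ 2) := by ring
  have hs : Real.sqrt (1 - x ^ 4) = Real.sqrt (1 - x ^ 2) * Real.sqrt (1 + x ^ 2) := by
    rw [e, Real.sqrt_mul (by linarith)]
  have ha : 0 < Real.sqrt (1 - x ^ 2) := Real.sqrt_pos.2 (by linarith)
  have hb : 0 < Real.sqrt (1 + x ^ 2) := Real.sqrt_pos.2 (by positivity)
  have hb2 : x ≤ 3 / 4 * Real.sqrt (1 + x ^ 2) := by
    have h := Real.sq_sqrt (show 0 ≤ 1 + x ^ 2 by positivity)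
    nlinarith
  have hspos : 0 < Real.sqrt (1 - x ^ 4) := by rw [hs]; positivity
  have hsq : Real.sqrt (1 - x ^ 4) ^ 2 = 1 - x ^ 4 := Real.sq_sqrt (by rw [e]; nlinarith)
  have hx4 : 0 < x ^ 4 := by positivity
  have hlt : Real.sqrt (1 - x ^ 4) < 1 := by nlinarith
  constructor
  · apply mul_pos (by positivity)
    rw [sub_pos, lt_div_iff₀ hspos]; linarith
  · have h1 : (1 / x ^ 2) * (1 / Real.sqrt (1 - x ^ 4) - 1) ≤ x ^ 2 / Real.sqrt (1 - x ^ 4) := by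
      have : (1 / x ^ 2) * (1 / Real.sqrt (1 - x ^ 4) - 1)
          = ((1 - Real.sqrt (1 - x ^ 4)) / x ^ 2) / Real.sqrt (1 - x ^ 4) := by
        field_simp
      rw [this]
      apply div_le_div_of_nonneg_right _ hspos.le
      rw [div_le_iff₀ (by positivity)]
      nlinarith
    refine h1.trans ?_
    rw [hs, div_le_iff₀ (by positivity)]
    have : 3 / 4 * (x / Real.sqrt (1 - x ^ 2)) * (Real.sqrt (1 - x ^ 2) * Real.sqrt (1 + x ^ 2))
        = x * (3 / 4 * Real.sqrt (1 + x ^ 2)) := by field_simp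
    rw [this]
    nlinarith

theorem K_between_zero_and_one :
    0 < (∫ x in Set.Ioo (0 : ℝ) 1, (1 / x ^ 2) * (1 / Real.sqrt (1 - x ^ 4) - 1)) ∧
    (∫ x in Set.Ioo (0 : ℝ) 1, (1 / x ^ 2) * (1 / Real.sqrt (1 - x ^ 4) - 1)) < 1 := by
  have hc : ContinuousOn (fun x : ℝ => -(3 / 4 * Real.sqrt (1 - x ^ 2))) (Set.Icc 0 1) := by
    fun_prop
  have hd : ∀ x ∈ Set.Ioo (0 : ℝ) 1, HasDerivAt (fun x : ℝ => -(3 / 4 * Real.sqrt (1 - x ^ 2)))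
      (3 / 4 * (x / Real.sqrt (1 - x ^ 2))) x := by
    rintro x ⟨h0, h1⟩
    have hx2 : 1 - x ^ 2 ≠ 0 := by nlinarith
    have h := ((((hasDerivAt_pow 2 x).const_sub 1).sqrt hx2).const_mul (3 / 4)).neg
    have hs : Real.sqrt (1 - x ^ 2) ≠ 0 := (Real.sqrt_pos.2 (by nlinarith)).ne'
    refine h.congr_deriv ?_
    push_cast
    field_simp
  have hi : IntegrableOn (fun x : ℝ => 3 / 4 * (x / Real.sqrt (1 - x ^ 2))) (Set.Ioc 0 1) := by
    apply intervalIntegral.integrableOn_deriv_of_nonneg hc hd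
    rintro x ⟨h0, h1⟩
    positivity
  have hI : ∫ x in (0 : ℝ)..1, 3 / 4 * (x / Real.sqrt (1 - x ^ 2)) = 3 / 4 := by
    rw [intervalIntegral.integral_eq_sub_of_hasDerivAt_of_le zero_le_one hc hd
      ((intervalIntegrable_iff_integrableOn_Ioc_of_le zero_le_one).2 hi)]
    norm_num
  rw [intervalIntegral.integral_of_le zero_le_one, integral_Ioc_eq_integral_Ioo] at hI
  have hi' := hi.mono_set Set.Ioo_subset_Ioc_self
  have hf : IntegrableOn (fun x : ℝ => (1 / x ^ 2) * (1 / Real.sqrt (1 - x ^ 4) - 1))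
      (Set.Ioo 0 1) := by
    refine Integrable.mono' hi' (Measurable.aestronglyMeasurable (by fun_prop)) ?_
    refine (ae_restrict_iff' measurableSet_Ioo).2 (Filter.Eventually.of_forall ?_)
    rintro x ⟨h0, h1⟩
    have := K_aux_bound x h0 h1
    rw [Real.norm_of_nonneg this.1.le]
    exact this.2
  constructor
  · rw [← integral_Ioc_eq_integral_Ioo, ← intervalIntegral.integral_of_le zero_le_one]
    apply intervalIntegral.intervalIntegral_pos_of_pos_on
    · rwa [intervalIntegrable_iff_integrableOn_Ioo_of_le zero_le_one]
    · rintro x ⟨h0, h1⟩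
      exact (K_aux_bound x h0 h1).1
    · exact zero_lt_one
  · have := setIntegral_mono_on hf hi' measurableSet_Ioo
      (fun x hx => (K_aux_bound x hx.1 hx.2).2)
    rw [hI] at this
    linarith
end

section
/- For every real number λ > 0, f(λ) < K · cosh λ, where f(λ) = ∫_λ^∞ sinh t · ( sinh(2t)/√(sinh(2t)² − sinh(2λ)²) − 1 ) dt and K = ∫_0^1 (1/x²) · ( 1/√(1−x⁴) − 1 ) dx. -/
open Real MeasureTheory

lemma kint : IntegrableOn (fun x : ℝ => (1 / x ^ 2) * (1 / Real.sqrt (1 - x ^ 4) - 1))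
    (Set.Ioo (0 : ℝ) 1) := by
  have h1 : IntegrableOn (fun x : ℝ => (1 - x) ^ (-(1/2) : ℝ)) (Set.Ioo (0 : ℝ) 1) := by
    have h := (intervalIntegral.intervalIntegrable_rpow' (a := 0) (b := 1)
      (r := (-(1/2) : ℝ)) (by norm_num)).comp_sub_left 1
    simp only [sub_zero, sub_self] at h
    exact (intervalIntegrable_iff_integrableOn_Ioo_of_le (by norm_num)).1 h.symm
  refine Integrable.mono' h1 ?_ ?_
  · exact (by fun_prop : Measurable _).aestronglyMeasurable
  · filter_upwards [ae_restrict_mem measurableSet_Ioo] with x hx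
    obtain ⟨h0, hx1⟩ := hx
    have h4 : x ^ 4 ≤ x := by
      have := pow_le_pow_of_le_one h0.le hx1.le (show 1 ≤ 4 by norm_num)
      simpa using this
    have hp : 0 < 1 - x ^ 4 := by linarith
    have hs : 0 < √(1 - x ^ 4) := Real.sqrt_pos.2 hp
    have hsq : √(1 - x ^ 4) ^ 2 = 1 - x ^ 4 := Real.sq_sqrt hp.le
    have hle : √(1 - x) ≤ √(1 - x ^ 4) := Real.sqrt_le_sqrt (by linarith)
    have hs' : 0 < √(1 - x) := Real.sqrt_pos.2 (by linarith)
    set s := √(1 - x ^ 4)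
    have e : (1 / x ^ 2) * (1 / s - 1) = x ^ 2 / (s * (1 + s)) := by
      field_simp
      linear_combination (-1 : ℝ) * hsq
    rw [e, Real.norm_of_nonneg (by positivity), Real.rpow_neg (by linarith),
      ← Real.sqrt_eq_rpow, ← one_div]
    apply div_le_div₀ (by norm_num) _ hs'
    · nlinarith
    · nlinarith

lemma img (l : ℝ) (hl : 0 < l) :
    Set.image (fun t => Real.cosh l / Real.cosh t) (Set.Ioi l) = Set.Ioo (0 : ℝ) 1 := by
  have hc := Real.cosh_pos l
  ext x
  constructor
  · rintro ⟨t, ht, rfl⟩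
    have ht' : l < t := ht
    have hu := Real.cosh_pos t
    refine ⟨by positivity, ?_⟩
    show Real.cosh l / Real.cosh t < 1
    rw [div_lt_one hu]
    exact Real.cosh_strictMonoOn (Set.mem_Ici.2 hl.le) (Set.mem_Ici.2 (by linarith)) ht'
  · rintro ⟨h0, h1⟩
    have hlt : Real.cosh l < Real.cosh l / x := by
      rw [lt_div_iff₀ h0]; nlinarith
    have h1c := Real.one_le_cosh l
    refine ⟨Real.arcosh (Real.cosh l / x), ?_, ?_⟩
    · show l < _
      calc l = Real.arcosh (Real.cosh l) := (Real.arcosh_cosh hl.le).symm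
        _ < _ := (Real.arcosh_lt_arcosh hc (by positivity)).2 hlt
    · show Real.cosh l / Real.cosh (Real.arcosh (Real.cosh l / x)) = x
      rw [Real.cosh_arcosh (by linarith)]
      field_simp

lemma ptwise (l t : ℝ) (hl : 0 < l) (ht : l < t) :
    0 ≤ Real.sinh t *
        (Real.sinh (2 * t) / Real.sqrt ((Real.sinh (2 * t)) ^ 2 - (Real.sinh (2 * l)) ^ 2) - 1) ∧
    Real.sinh t *
        (Real.sinh (2 * t) / Real.sqrt ((Real.sinh (2 * t)) ^ 2 - (Real.sinh (2 * l)) ^ 2) - 1)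
      < Real.sinh t * (1 / √(1 - (Real.cosh l / Real.cosh t) ^ 4) - 1) := by
  have hcu : Real.cosh l < Real.cosh t :=
    Real.cosh_strictMonoOn (Set.mem_Ici.2 hl.le) (Set.mem_Ici.2 (by linarith)) ht
  have hc := Real.cosh_pos l
  have hu := Real.cosh_pos t
  have hst : 0 < Real.sinh t := Real.sinh_pos_iff.2 (by linarith)
  have hs2t : 0 < Real.sinh (2 * t) := Real.sinh_pos_iff.2 (by linarith)
  have hs2l : 0 < Real.sinh (2 * l) := Real.sinh_pos_iff.2 (by linarith)
  have hlt : Real.sinh (2 * l) < Real.sinh (2 * t) := Real.sinh_lt_sinh.2 (by linarith)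
  set S := Real.sinh (2 * t) with hS
  set L := Real.sinh (2 * l) with hL
  have hD : 0 < S ^ 2 - L ^ 2 := by nlinarith
  have hsD : 0 < √(S ^ 2 - L ^ 2) := Real.sqrt_pos.2 hD
  have hle : √(S ^ 2 - L ^ 2) ≤ S := by
    rw [Real.sqrt_le_left hs2t.le]; nlinarith
  refine ⟨mul_nonneg hst.le (sub_nonneg.2 ((one_le_div hsD).2 hle)), ?_⟩
  apply mul_lt_mul_of_pos_left _ hst
  apply sub_lt_sub_right
  have hx1 : (Real.cosh l / Real.cosh t) ^ 4 < 1 :=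
    pow_lt_one₀ (by positivity) ((div_lt_one hu).2 hcu) (by norm_num)
  have hE : 0 < 1 - (Real.cosh l / Real.cosh t) ^ 4 := by linarith
  have hsE := Real.sqrt_pos.2 hE
  rw [div_lt_div_iff₀ hsD hsE, one_mul]
  have : S * √(1 - (Real.cosh l / Real.cosh t) ^ 4)
      = √(S ^ 2 * (1 - (Real.cosh l / Real.cosh t) ^ 4)) := by
    rw [Real.sqrt_mul (by positivity), Real.sqrt_sq hs2t.le]
  rw [this]
  apply Real.sqrt_lt_sqrt (by positivity)
  have hS2 : S ^ 2 = 4 * (Real.cosh t ^ 2 - 1) * Real.cosh t ^ 2 := by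
    rw [hS, Real.sinh_two_mul, mul_pow, mul_pow, Real.sinh_sq]; ring
  have hL2 : L ^ 2 = 4 * (Real.cosh l ^ 2 - 1) * Real.cosh l ^ 2 := by
    rw [hL, Real.sinh_two_mul, mul_pow, mul_pow, Real.sinh_sq]; ring
  have key : L ^ 2 < S ^ 2 * (Real.cosh l / Real.cosh t) ^ 4 := by
    rw [hS2, hL2, div_pow, mul_div_assoc', lt_div_iff₀ (by positivity)]
    have h2 : Real.cosh l ^ 2 < Real.cosh t ^ 2 := by nlinarith
    have h3 : 0 < 4 * Real.cosh l ^ 2 * Real.cosh t ^ 2 * (Real.cosh t ^ 2 - Real.cosh l ^ 2) :=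
      mul_pos (by positivity) (by linarith)
    nlinarith
  linarith

theorem f_lt_K_mul_cosh (l : ℝ) (hl : 0 < l) :
    (∫ t in Set.Ioi l, Real.sinh t *
        (Real.sinh (2 * t) / Real.sqrt ((Real.sinh (2 * t)) ^ 2 - (Real.sinh (2 * l)) ^ 2) - 1))
      <
    (∫ x in Set.Ioo (0 : ℝ) 1, (1 / x ^ 2) * (1 / Real.sqrt (1 - x ^ 4) - 1)) * Real.cosh l := by
  have hc := Real.cosh_pos l
  have hder : ∀ t ∈ Set.Ioi l, HasDerivWithinAt (fun t => Real.cosh l / Real.cosh t)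
      (-(Real.cosh l * Real.sinh t) / Real.cosh t ^ 2) (Set.Ioi l) t := by
    intro t _
    have h := ((hasDerivAt_const t (Real.cosh l)).div (Real.hasDerivAt_cosh t)
      (Real.cosh_pos t).ne')
    refine (h.congr_deriv ?_).hasDerivWithinAt
    ring
  have hinj : Set.InjOn (fun t => Real.cosh l / Real.cosh t) (Set.Ioi l) := by
    intro a ha b hb hab
    have ha' : l < a := ha
    have hb' : l < b := hb
    have h : Real.cosh l / Real.cosh a = Real.cosh l / Real.cosh b := hab
    rw [div_eq_div_iff (Real.cosh_pos a).ne' (Real.cosh_pos b).ne'] at h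
    exact (Real.cosh_injOn (Set.mem_Ici.2 (by linarith)) (Set.mem_Ici.2 (by linarith))
      (mul_left_cancel₀ hc.ne' h)).symm
  have hcongr : Set.EqOn (fun t => |(-(Real.cosh l * Real.sinh t) / Real.cosh t ^ 2)| •
        ((1 / (Real.cosh l / Real.cosh t) ^ 2) *
          (1 / Real.sqrt (1 - (Real.cosh l / Real.cosh t) ^ 4) - 1)))
      (fun t => (Real.sinh t * (1 / √(1 - (Real.cosh l / Real.cosh t) ^ 4) - 1)) / Real.cosh l)
      (Set.Ioi l) := by
    intro t ht
    have ht' : l < t := ht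
    have hst : 0 < Real.sinh t := Real.sinh_pos_iff.2 (by linarith)
    have hu := Real.cosh_pos t
    have e : |(-(Real.cosh l * Real.sinh t) / Real.cosh t ^ 2)|
        = Real.cosh l * Real.sinh t / Real.cosh t ^ 2 := by
      rw [neg_div, abs_neg, abs_of_pos (by positivity)]
    simp only [e, smul_eq_mul]
    generalize 1 / √(1 - (Real.cosh l / Real.cosh t) ^ 4) - 1 = y
    field_simp
  have hK := integral_image_eq_integral_abs_deriv_smul measurableSet_Ioi hder hinj
    (fun x : ℝ => (1 / x ^ 2) * (1 / Real.sqrt (1 - x ^ 4) - 1))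
  have hI := (integrableOn_image_iff_integrableOn_abs_deriv_smul measurableSet_Ioi hder hinj
    (fun x : ℝ => (1 / x ^ 2) * (1 / Real.sqrt (1 - x ^ 4) - 1))).1
      (by rw [img l hl]; exact kint)
  rw [img l hl, setIntegral_congr_fun measurableSet_Ioi hcongr, integral_div] at hK
  have hI2 := (integrableOn_congr_fun hcongr measurableSet_Ioi).1 hI
  have hG : IntegrableOn (fun t => Real.sinh t * (1 / √(1 - (Real.cosh l / Real.cosh t) ^ 4) - 1))
      (Set.Ioi l) := by
    have := Integrable.mul_const hI2 (Real.cosh l)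
    simp only [div_mul_cancel₀ _ hc.ne'] at this
    exact this
  rw [hK, div_mul_cancel₀ _ hc.ne']
  have hF : IntegrableOn (fun t => Real.sinh t *
        (Real.sinh (2 * t) / Real.sqrt ((Real.sinh (2 * t)) ^ 2 - (Real.sinh (2 * l)) ^ 2) - 1))
      (Set.Ioi l) := by
    refine Integrable.mono' hG (by fun_prop : Measurable _).aestronglyMeasurable ?_
    filter_upwards [ae_restrict_mem measurableSet_Ioi] with t ht
    have h := ptwise l t hl ht
    rw [Real.norm_of_nonneg h.1]
    exact h.2.le
  rw [← sub_pos, ← integral_sub hG hF]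
  refine (setIntegral_pos_iff_support_of_nonneg_ae ?_ (hG.sub hF)).2 ?_
  rotate_left
  · have hsub : Set.Ioi l ⊆ Function.support (fun t =>
        Real.sinh t * (1 / √(1 - (Real.cosh l / Real.cosh t) ^ 4) - 1) - Real.sinh t *
        (Real.sinh (2 * t) / Real.sqrt ((Real.sinh (2 * t)) ^ 2 - (Real.sinh (2 * l)) ^ 2) - 1)) := by
      intro t ht
      exact (sub_pos.2 (ptwise l t hl ht).2).ne'
    refine lt_of_lt_of_le ?_ (measure_mono (Set.subset_inter hsub subset_rfl))
    simp
  · filter_upwards [ae_restrict_mem measurableSet_Ioi] with t ht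
    exact (sub_pos.2 (ptwise l t hl ht).2).le
end

section
/- Let K = ∫_0^1 (1/x²) · ( 1/√(1−x⁴) − 1 ) dx and Λ₀ = arcosh(1/(1−K)). Then for every λ ≥ Λ₀, one has f(λ) < cosh λ − 1, where f(λ) = ∫_λ^∞ sinh t · ( sinh(2t)/√(sinh(2t)² − sinh(2λ)²) − 1 ) dt. -/
open Real MeasureTheory

lemma aux_bound (x : ℝ) (h0 : 0 < x) (h1 : x < 1) :
    0 < (1 / x ^ 2) * (1 / Real.sqrt (1 - x ^ 4) - 1) ∧
    (1 / x ^ 2) * (1 / Real.sqrt (1 - x ^ 4) - 1) ≤ (1 - x) ^ (-(1/2) : ℝ) := by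
  have hx4 : x ^ 4 ≤ x := by
    have := pow_le_pow_of_le_one h0.le h1.le (show 1 ≤ 4 by norm_num)
    simpa using this
  have hx4p : 0 < x ^ 4 := by positivity
  have hx2 : x ^ 2 ≤ 1 := by nlinarith
  have hA : 0 < 1 - x ^ 4 := by linarith
  set s := Real.sqrt (1 - x ^ 4) with hs
  have hsp : 0 < s := Real.sqrt_pos.2 hA
  have hss : s ^ 2 = 1 - x ^ 4 := Real.sq_sqrt hA.le
  have hs1 : s < 1 := by nlinarith
  constructor
  · have : 1 < 1 / s := by rw [lt_div_iff₀ hsp]; linarith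
    have h2 : 0 < 1 / s - 1 := by linarith
    positivity
  · have hr : (1 - x) ^ (-(1/2) : ℝ) = 1 / Real.sqrt (1 - x) := by
      rw [Real.rpow_neg (by linarith), Real.sqrt_eq_rpow, one_div ((1 - x) ^ (1/2 : ℝ))]
    rw [hr]
    have hle : Real.sqrt (1 - x) ≤ s := Real.sqrt_le_sqrt (by linarith)
    have hp : 0 < Real.sqrt (1 - x) := Real.sqrt_pos.2 (by linarith)
    calc (1 / x ^ 2) * (1 / s - 1) ≤ 1 / s := by
          rw [show (1 / x ^ 2) * (1 / s - 1) = ((1 - s) / x ^ 2) * (1 / s) by field_simp]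
          have : (1 - s) / x ^ 2 ≤ 1 := by
            rw [div_le_one (by positivity)]
            nlinarith
          have h3 : 0 < 1 / s := by positivity
          nlinarith
      _ ≤ _ := one_div_le_one_div_of_le hp hle

lemma aux_int : IntegrableOn (fun x : ℝ => (1 / x ^ 2) * (1 / Real.sqrt (1 - x ^ 4) - 1))
    (Set.Ioo 0 1) := by
  have h1 : IntervalIntegrable (fun x : ℝ => x ^ (-(1/2) : ℝ)) volume 0 1 :=
    intervalIntegral.intervalIntegrable_rpow' (by norm_num)
  have h2 := h1.comp_sub_left 1
  simp only [sub_zero, sub_self] at h2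
  have h3 : IntegrableOn (fun x : ℝ => (1 - x) ^ (-(1/2) : ℝ)) (Set.Ioo 0 1) :=
    ((intervalIntegrable_iff_integrableOn_Ioo_of_le zero_le_one).1 h2.symm)
  refine Integrable.mono' h3 ?_ ?_
  · exact Measurable.aestronglyMeasurable (by fun_prop)
  · refine (ae_restrict_iff' measurableSet_Ioo).2 (Filter.Eventually.of_forall fun x hx => ?_)
    obtain ⟨ha, hb⟩ := aux_bound x hx.1 hx.2
    rw [Real.norm_of_nonneg ha.le]
    exact hb

lemma aux_image (l : ℝ) (hl : 0 ≤ l) :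
    (fun t => cosh l / cosh t) '' Set.Ioi l = Set.Ioo 0 1 := by
  ext x
  constructor
  · rintro ⟨t, ht, rfl⟩
    have ht' : l < t := ht
    refine ⟨div_pos (cosh_pos _) (cosh_pos _), ?_⟩
    show cosh l / cosh t < 1
    rw [div_lt_one (cosh_pos _), Real.cosh_lt_cosh, abs_of_nonneg hl, abs_of_pos (by linarith)]
    exact ht
  · rintro ⟨h0, h1⟩
    have hc : cosh l < cosh l / x := by
      rw [lt_div_iff₀ h0]; nlinarith [cosh_pos l]
    have h1c : 1 ≤ cosh l / x := (one_le_cosh l).trans hc.le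
    refine ⟨arcosh (cosh l / x), ?_, ?_⟩
    · show l < _
      have := Real.arcosh_nonneg h1c
      have h6 : cosh l < cosh (arcosh (cosh l / x)) := by
        rw [Real.cosh_arcosh h1c]; exact hc
      rwa [Real.cosh_lt_cosh, abs_of_nonneg hl, abs_of_nonneg this] at h6
    · show cosh l / cosh (arcosh (cosh l / x)) = x
      rw [Real.cosh_arcosh h1c]
      have := cosh_pos l
      field_simp

lemma aux_lt (l t : ℝ) (hl : 0 < l) (ht : l < t) :
    Real.sinh t * (Real.sinh (2 * t) /
      Real.sqrt ((Real.sinh (2 * t)) ^ 2 - (Real.sinh (2 * l)) ^ 2) - 1)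
    < Real.sinh t * (1 / Real.sqrt (1 - (cosh l / cosh t) ^ 4) - 1) := by
  have hst : 0 < sinh t := Real.sinh_pos_iff.2 (by linarith)
  refine mul_lt_mul_of_pos_left ?_ hst
  refine sub_lt_sub_right ?_ 1
  have hS : 0 < sinh (2 * t) := Real.sinh_pos_iff.2 (by linarith)
  have hs : 0 < sinh (2 * l) := Real.sinh_pos_iff.2 (by linarith)
  have hSs : sinh (2 * l) < sinh (2 * t) := Real.sinh_lt_sinh.2 (by linarith)
  have hc : 0 < cosh l := cosh_pos l
  have hC : 0 < cosh t := cosh_pos t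
  have hcC : cosh l < cosh t := by
    rw [Real.cosh_lt_cosh, abs_of_pos hl, abs_of_pos (by linarith)]; exact ht
  have hA : 0 < sinh (2 * t) ^ 2 - sinh (2 * l) ^ 2 := by nlinarith
  have hr : cosh l / cosh t < 1 := (div_lt_one hC).2 hcC
  have hr0 : 0 < cosh l / cosh t := div_pos hc hC
  have hB : 0 < 1 - (cosh l / cosh t) ^ 4 := by
    have := pow_lt_one₀ hr0.le hr (show 4 ≠ 0 by norm_num)
    linarith
  rw [div_lt_div_iff₀ (Real.sqrt_pos.2 hA) (Real.sqrt_pos.2 hB), one_mul]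
  apply Real.lt_sqrt_of_sq_lt
  rw [mul_pow, Real.sq_sqrt hB.le]
  have e1 : sinh (2 * t) ^ 2 = 4 * (cosh t ^ 2 - 1) * cosh t ^ 2 := by
    rw [Real.sinh_two_mul, mul_pow, mul_pow, Real.sinh_sq]; ring
  have e2 : sinh (2 * l) ^ 2 = 4 * (cosh l ^ 2 - 1) * cosh l ^ 2 := by
    rw [Real.sinh_two_mul, mul_pow, mul_pow, Real.sinh_sq]; ring
  rw [e1, e2]
  have hsq : cosh l ^ 2 < cosh t ^ 2 := by nlinarith
  have e3 : 4 * (cosh t ^ 2 - 1) * cosh t ^ 2 * (1 - (cosh l / cosh t) ^ 4)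
      = 4 * (cosh t ^ 2 - 1) * cosh t ^ 2 - 4 * cosh l ^ 4 + 4 * cosh l ^ 4 / cosh t ^ 2 := by
    field_simp
    ring
  have e4 : cosh l ^ 4 / cosh t ^ 2 < cosh l ^ 2 := by
    rw [div_lt_iff₀ (by positivity)]
    have : 0 < cosh l ^ 2 := by positivity
    nlinarith
  rw [e3]
  have e5 : 4 * cosh l ^ 4 / cosh t ^ 2 = 4 * (cosh l ^ 4 / cosh t ^ 2) := by ring
  rw [e5]
  nlinarith

lemma aux_pos {F : ℝ → ℝ} {s : Set ℝ} (hs : MeasurableSet s) (hv : volume s ≠ 0)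
    (hF : ∀ x ∈ s, 0 < F x) (hi : IntegrableOn F s) : 0 < ∫ x in s, F x := by
  rw [setIntegral_pos_iff_support_of_nonneg_ae
    ((ae_restrict_iff' hs).2 (Filter.Eventually.of_forall fun x hx => (hF x hx).le)) hi]
  have hsub : s ⊆ Function.support F := fun x hx => (hF x hx).ne'
  rw [Set.inter_eq_right.2 hsub]
  exact pos_iff_ne_zero.2 hv

theorem f_lt_cosh_sub_one_of_ge_Lambda0
    (K Λ₀ : ℝ)
    (hK : K = ∫ x in Set.Ioo (0 : ℝ) 1, (1 / x ^ 2) * (1 / Real.sqrt (1 - x ^ 4) - 1))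
    (hΛ₀ : 0 ≤ Λ₀) (hcosh : Real.cosh Λ₀ = 1 / (1 - K)) :
    ∀ l : ℝ, Λ₀ ≤ l →
      (∫ t in Set.Ioi l, Real.sinh t *
          (Real.sinh (2 * t) / Real.sqrt ((Real.sinh (2 * t)) ^ 2 - (Real.sinh (2 * l)) ^ 2) - 1))
        < Real.cosh l - 1 := by
  intro l hl
  have hKpos : 0 < K := by
    rw [hK]
    exact aux_pos measurableSet_Ioo (by simp) (fun x hx => (aux_bound x hx.1 hx.2).1) aux_int
  have hK1 : 0 < 1 - K := by
    have := cosh_pos Λ₀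
    rw [hcosh] at this
    exact one_div_pos.1 this
  have hΛpos : 0 < Λ₀ := by
    rcases hΛ₀.lt_or_eq with h | h
    · exact h
    · rw [← h, Real.cosh_zero, eq_div_iff hK1.ne'] at hcosh
      linarith
  have hlpos : 0 < l := by linarith
  have hc : 0 < cosh l := cosh_pos l
  have hle : K * cosh l ≤ cosh l - 1 := by
    have h1 : cosh Λ₀ ≤ cosh l := by
      rw [Real.cosh_le_cosh, abs_of_pos hΛpos, abs_of_pos hlpos]; exact hl
    rw [hcosh, div_le_iff₀ hK1] at h1
    linarith
  refine lt_of_lt_of_le ?_ hle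
  -- change of variables
  have hder : ∀ t ∈ Set.Ioi l, HasDerivWithinAt (fun t => cosh l / cosh t)
      (-(cosh l * sinh t) / cosh t ^ 2) (Set.Ioi l) t := by
    intro t _
    have := (hasDerivAt_const t (cosh l)).div (Real.hasDerivAt_cosh t) (cosh_pos t).ne'
    have h2 := this.hasDerivWithinAt (s := Set.Ioi l)
    rw [zero_mul, zero_sub] at h2
    exact h2
  have hinj : Set.InjOn (fun t => cosh l / cosh t) (Set.Ioi l) := by
    intro a ha b hb hab
    have ha' : l < a := ha
    have hb' : l < b := hb
    have hab' : cosh l / cosh a = cosh l / cosh b := hab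
    rw [div_eq_div_iff (cosh_pos a).ne' (cosh_pos b).ne'] at hab'
    have h3 : cosh b = cosh a := mul_left_cancel₀ hc.ne' hab'
    have h4 := Real.cosh_le_cosh.1 h3.le
    have h5 := Real.cosh_le_cosh.1 h3.ge
    rw [abs_of_pos (by linarith), abs_of_pos (by linarith)] at h4 h5
    linarith
  have heq : ∀ t ∈ Set.Ioi l, |(-(cosh l * sinh t) / cosh t ^ 2)| •
      ((1 / (cosh l / cosh t) ^ 2) * (1 / Real.sqrt (1 - (cosh l / cosh t) ^ 4) - 1))
      = (sinh t * (1 / Real.sqrt (1 - (cosh l / cosh t) ^ 4) - 1)) / cosh l := by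
    intro t ht
    have ht' : l < t := ht
    have hst : 0 < sinh t := Real.sinh_pos_iff.2 (by linarith)
    have hC := cosh_pos t
    rw [neg_div, abs_neg, abs_of_pos (by positivity), smul_eq_mul]
    generalize 1 / Real.sqrt (1 - (cosh l / cosh t) ^ 4) - 1 = w
    field_simp
  have hG := (integrableOn_image_iff_integrableOn_abs_deriv_smul measurableSet_Ioi hder hinj
    (fun x : ℝ => (1 / x ^ 2) * (1 / Real.sqrt (1 - x ^ 4) - 1)))
  rw [aux_image l hlpos.le] at hG
  have hG1 := hG.1 aux_int
  rw [integrableOn_congr_fun heq measurableSet_Ioi] at hG1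
  have hGi : IntegrableOn
      (fun t => sinh t * (1 / Real.sqrt (1 - (cosh l / cosh t) ^ 4) - 1)) (Set.Ioi l) := by
    have := hG1.mul_const (cosh l)
    simp only [div_mul_cancel₀ _ hc.ne'] at this
    exact this
  have hI := (integral_image_eq_integral_abs_deriv_smul measurableSet_Ioi hder hinj
    (fun x : ℝ => (1 / x ^ 2) * (1 / Real.sqrt (1 - x ^ 4) - 1)))
  rw [aux_image l hlpos.le, ← hK, setIntegral_congr_fun measurableSet_Ioi heq,
    integral_div, eq_div_iff hc.ne'] at hI
  by_cases hF : IntegrableOn (fun t => Real.sinh t *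
          (Real.sinh (2 * t) / Real.sqrt ((Real.sinh (2 * t)) ^ 2 - (Real.sinh (2 * l)) ^ 2) - 1))
          (Set.Ioi l)
  · rw [hI, ← sub_pos, ← integral_sub hGi hF]
    refine aux_pos measurableSet_Ioi (by simp) (fun t ht => ?_) (hGi.sub hF)
    exact sub_pos.2 (aux_lt l t hlpos ht)
  · rw [integral_undef hF]
    positivity
end

section
/- For each fixed real number λ > 0, the function t ↦ sinh(2λ)/( cosh t · √(sinh(2t)² − sinh(2λ)²) ) is integrable on the interval (λ, ∞); in particular d₀(λ) = ∫_λ^∞ sinh(2λ)/( cosh t · √(sinh(2t)² − sinh(2λ)²) ) dt is a well-defined finite real number. -/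
open Real MeasureTheory

theorem d0_integrable (l : ℝ) (hl : 0 < l) :
    IntegrableOn
      (fun t : ℝ => Real.sinh (2 * l) /
        (Real.cosh t * Real.sqrt ((Real.sinh (2 * t)) ^ 2 - (Real.sinh (2 * l)) ^ 2)))
      (Set.Ioi l) := by
  have hS : 0 < Real.sinh (2 * l) := Real.sinh_pos_iff.2 (by linarith)
  have hG := Real.GammaIntegral_convergent (s := 1 / 2) (by norm_num)
  have hG2 : IntegrableOn (fun t : ℝ => Real.exp (-(t - l)) * (t - l) ^ ((1 / 2 : ℝ) - 1))
      (Set.Ioi l) := by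
    have h := (measurePreserving_sub_right volume l).integrableOn_comp_preimage
      (MeasurableEquiv.subRight l).measurableEmbedding
      (f := fun x : ℝ => Real.exp (-x) * x ^ ((1 / 2 : ℝ) - 1)) (s := Set.Ioi 0)
    have h2 := h.2 hG
    simpa [Function.comp_def] using h2
  refine Integrable.mono' (hG2.const_mul (2 * Real.sinh (2 * l) / √(Real.sinh (2 * l)))) ?_ ?_
  · apply Measurable.aestronglyMeasurable
    fun_prop
  · refine (ae_restrict_iff' measurableSet_Ioi).2 (Filter.Eventually.of_forall fun t ht => ?_)
    have hx : 0 < t - l := sub_pos.2 ht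
    obtain ⟨x, rfl⟩ : ∃ x, t = l + x := ⟨t - l, by ring⟩
    simp only [add_sub_cancel_left] at hx ⊢
    have h1 : Real.sinh (2 * l) + x ≤ Real.sinh (2 * (l + x)) := by
      rw [mul_add, Real.sinh_add]
      have a1 := Real.one_le_cosh (2 * x)
      have a2 := Real.one_le_cosh (2 * l)
      have a3 : 2 * x ≤ Real.sinh (2 * x) := Real.self_le_sinh_iff.2 (by linarith)
      nlinarith
    have h2 : √(Real.sinh (2 * l)) * √x ≤
        √((Real.sinh (2 * (l + x))) ^ 2 - (Real.sinh (2 * l)) ^ 2) := by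
      rw [← Real.sqrt_mul hS.le]
      apply Real.sqrt_le_sqrt
      nlinarith [mul_pos hS hx]
    have h3 : Real.exp x / 2 ≤ Real.cosh (l + x) := by
      rw [Real.cosh_eq]
      have : Real.exp x ≤ Real.exp (l + x) := Real.exp_le_exp.2 (by linarith)
      linarith [Real.exp_pos (-(l + x))]
    have hs : 0 < √(Real.sinh (2 * l)) := Real.sqrt_pos.2 hS
    have hsx : 0 < √x := Real.sqrt_pos.2 hx
    have he := Real.exp_pos x
    rw [Real.norm_of_nonneg (by have := Real.cosh_pos (l + x); positivity)]
    have h4 : x ^ ((1 / 2 : ℝ) - 1) = 1 / √x := by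
      rw [show (1 / 2 : ℝ) - 1 = -(1 / 2) by norm_num, Real.rpow_neg hx.le, ← Real.sqrt_eq_rpow,
        one_div]
    rw [h4, Real.exp_neg]
    calc _ ≤ Real.sinh (2 * l) / (Real.exp x / 2 * (√(Real.sinh (2 * l)) * √x)) := by
          gcongr
      _ = _ := by field_simp
end

section
/- For every real number λ > 0, one has d₀(λ) < π/(4 cosh λ), where d₀(λ) = ∫_λ^∞ sinh(2λ)/( cosh t · √(sinh(2t)² − sinh(2λ)²) ) dt. -/
open Real MeasureTheory

theorem d0_lt_pi_div_four_cosh (l : ℝ) (hl : 0 < l) :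
    (∫ t in Set.Ioi l, Real.sinh (2 * l) /
        (Real.cosh t * Real.sqrt ((Real.sinh (2 * t)) ^ 2 - (Real.sinh (2 * l)) ^ 2)))
      < Real.pi / (4 * Real.cosh l) := by
  set a := Real.sinh (2 * l) with ha
  have ha0 : 0 < a := Real.sinh_pos_iff.2 (by linarith)
  have hc0 : 0 < Real.cosh l := Real.cosh_pos l
  have hs : ∀ t ∈ Set.Ioi l, a < Real.sinh (2 * t) := fun t ht =>
    Real.sinh_lt_sinh.2 (by have : l < t := ht; linarith)
  have hpos : ∀ t ∈ Set.Ioi l, 0 < Real.sqrt (Real.sinh (2 * t) ^ 2 - a ^ 2) := fun t ht =>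
    Real.sqrt_pos.2 (by nlinarith [hs t ht])
  set f : ℝ → ℝ := fun t => a / (Real.cosh t * Real.sqrt (Real.sinh (2 * t) ^ 2 - a ^ 2)) with hf
  set g : ℝ → ℝ := fun t => a * Real.cosh (2 * t) /
    (Real.cosh l * Real.sinh (2 * t) * Real.sqrt (Real.sinh (2 * t) ^ 2 - a ^ 2)) with hg
  set G : ℝ → ℝ := fun t => -(1 / (2 * Real.cosh l)) * Real.arcsin (a / Real.sinh (2 * t)) with hG
  have hfpos : ∀ t ∈ Set.Ioi l, 0 < f t := fun t ht =>
    div_pos ha0 (mul_pos (Real.cosh_pos t) (hpos t ht))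
  have hfg : ∀ t ∈ Set.Ioi l, f t < g t := by
    intro t ht
    have h1 := hs t ht
    have h2 := hpos t ht
    have h3 : Real.cosh l < Real.cosh t := by
      have h4 : l < t := ht
      rw [Real.cosh_lt_cosh, abs_of_pos hl, abs_of_pos (hl.trans h4)]; exact h4
    have h5 : Real.sinh (2 * t) < Real.cosh (2 * t) := Real.sinh_lt_cosh _
    have h6 : 0 < Real.sinh (2 * t) := ha0.trans h1
    simp only [hf, hg]
    rw [div_lt_div_iff₀ (mul_pos (Real.cosh_pos t) h2) (mul_pos (mul_pos hc0 h6) h2)]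
    have h7 : Real.cosh l * Real.sinh (2 * t) < Real.cosh (2 * t) * Real.cosh t := by
      nlinarith
    have h8 := mul_lt_mul_of_pos_left h7 (mul_pos ha0 h2)
    nlinarith [h8]
  have hder : ∀ t ∈ Set.Ioi l, HasDerivAt G (g t) t := by
    intro t ht
    have h1 := hs t ht
    have h2 := hpos t ht
    have h6 : 0 < Real.sinh (2 * t) := ha0.trans h1
    have hlt : a / Real.sinh (2 * t) < 1 := (div_lt_one h6).2 h1
    have hgt : 0 < a / Real.sinh (2 * t) := div_pos ha0 h6
    have hd1 : HasDerivAt (fun t : ℝ => Real.sinh (2 * t)) (Real.cosh (2 * t) * (2 * 1)) t :=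
      ((hasDerivAt_id t).const_mul 2).sinh
    have hd2 := (hasDerivAt_const t a).div hd1 h6.ne'
    have hd3 := (Real.hasDerivAt_arcsin (by linarith) hlt.ne).comp t hd2
    have hd4 := hd3.const_mul (-(1 / (2 * Real.cosh l)))
    refine hd4.congr_deriv ?_
    have hsq : Real.sqrt (1 - (a / Real.sinh (2 * t)) ^ 2)
        = Real.sqrt (Real.sinh (2 * t) ^ 2 - a ^ 2) / Real.sinh (2 * t) := by
      rw [show 1 - (a / Real.sinh (2 * t)) ^ 2
        = (Real.sinh (2 * t) ^ 2 - a ^ 2) / Real.sinh (2 * t) ^ 2 by field_simp]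
      rw [Real.sqrt_div' _ (sq_nonneg _), Real.sqrt_sq h6.le]
    simp only [Pi.div_apply, hg]
    rw [hsq]
    generalize Real.sqrt (Real.sinh (2 * t) ^ 2 - a ^ 2) = r at *
    field_simp
    ring
  have hcont : ContinuousWithinAt G (Set.Ici l) l := by
    apply ContinuousAt.continuousWithinAt
    apply ContinuousAt.mul continuousAt_const
    apply Real.continuous_arcsin.continuousAt.comp
    exact ContinuousAt.div continuousAt_const (by fun_prop) ha0.ne'
  have hlim : Filter.Tendsto G Filter.atTop (nhds 0) := by
    have h1 : Filter.Tendsto (fun t : ℝ => Real.sinh (2 * t)) Filter.atTop Filter.atTop := by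
      refine Filter.tendsto_atTop_mono' _ ?_ (Filter.tendsto_id)
      filter_upwards [Filter.eventually_gt_atTop 0] with t ht
      have := Real.self_le_sinh_iff.2 (show 0 ≤ 2 * t by linarith)
      simp only [id]; linarith
    have h2 := (h1.const_div_atTop a)
    have h3 := (Real.continuous_arcsin.tendsto 0).comp h2
    have h4 := h3.const_mul (-(1 / (2 * Real.cosh l)))
    rw [Real.arcsin_zero, mul_zero] at h4
    exact h4
  have hgpos : ∀ t ∈ Set.Ioi l, 0 ≤ g t := fun t ht => ((hfpos t ht).trans (hfg t ht)).le
  have hgi : IntegrableOn g (Set.Ioi l) := integrableOn_Ioi_deriv_of_nonneg hcont hder hgpos hlim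
  have hgv : ∫ t in Set.Ioi l, g t = Real.pi / (4 * Real.cosh l) := by
    rw [integral_Ioi_of_hasDerivAt_of_nonneg hcont hder hgpos hlim]
    simp only [hG, ← ha, div_self ha0.ne', Real.arcsin_one]
    field_simp
    ring
  have hfi : IntegrableOn f (Set.Ioi l) := by
    refine Integrable.mono' hgi ?_ ?_
    · apply Measurable.aestronglyMeasurable
      have := Real.measurable_cosh
      have := Real.measurable_sinh
      fun_prop
    · filter_upwards [ae_restrict_mem measurableSet_Ioi] with t ht
      rw [Real.norm_of_nonneg (hfpos t ht).le]
      exact (hfg t ht).le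
  rw [← hgv, ← sub_pos, ← integral_sub hgi hfi]
  change 0 < ∫ t in Set.Ioi l, (g - f) t
  rw [setIntegral_pos_iff_support_of_nonneg_ae _ (hgi.sub hfi)]
  · have : Function.support (g - f) ∩ Set.Ioi l = Set.Ioi l :=
      Set.inter_eq_right.2 fun t ht => (sub_pos.2 (hfg t ht)).ne'
    rw [this]; simp
  · filter_upwards [ae_restrict_mem measurableSet_Ioi] with t ht
    exact (sub_pos.2 (hfg t ht)).le
end

section
/- The function d₀ tends to 0 both as λ → 0⁺ and as λ → ∞, where d₀(λ) = ∫_λ^∞ sinh(2λ)/( cosh t · √(sinh(2t)² − sinh(2λ)²) ) dt for λ > 0. -/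
open Real MeasureTheory Filter

noncomputable def gAux (u : ℝ) : ℝ := (Real.sqrt (u * Real.exp u))⁻¹

lemma gAux_int : IntegrableOn gAux (Set.Ioi 0) := by
  have h := integrableOn_rpow_mul_exp_neg_mul_rpow (p := 1) (s := -(1/2)) (b := 1/2)
    (by norm_num) (by norm_num) (by norm_num)
  refine h.congr_fun ?_ measurableSet_Ioi
  intro u hu
  have hu : 0 < u := hu
  simp only [gAux]
  rw [Real.sqrt_mul hu.le, mul_inv, Real.rpow_neg hu.le, ← Real.sqrt_eq_rpow, Real.rpow_one,
    ← Real.exp_half, ← Real.exp_neg]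
  congr 2
  ring

lemma key_bound (l K : ℝ) (hl : 0 < l) (hK : 0 ≤ K)
    (h : ∀ t, l < t → Real.sinh (2 * l) ≤
      K * (Real.cosh t * Real.sqrt (Real.sinh (2 * (t + l))))) :
    ‖∫ t in Set.Ioi l, Real.sinh (2 * l) /
        (Real.cosh t * Real.sqrt ((Real.sinh (2 * t)) ^ 2 - (Real.sinh (2 * l)) ^ 2))‖
      ≤ K * ∫ u in Set.Ioi 0, gAux u := by
  have hG : Integrable ((Set.Ioi (0:ℝ)).indicator gAux) :=
    (integrable_indicator_iff measurableSet_Ioi).2 gAux_int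
  have hG' := (hG.comp_sub_right l).const_mul K
  rw [← integral_indicator measurableSet_Ioi, ← integral_indicator measurableSet_Ioi,
    ← integral_sub_right_eq_self ((Set.Ioi (0:ℝ)).indicator gAux) l, ← integral_const_mul]
  refine norm_integral_le_of_norm_le hG' (Eventually.of_forall fun t => ?_)
  by_cases ht : l < t
  · have hu : 0 < t - l := sub_pos.2 ht
    rw [Set.indicator_of_mem (show t ∈ Set.Ioi l from ht),
      Set.indicator_of_mem (show t - l ∈ Set.Ioi (0:ℝ) from hu)]
    have hs : 0 < Real.sinh (2 * l) := Real.sinh_pos_iff.2 (by linarith)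
    have hs2 : 0 < Real.sinh (2 * (t + l)) := Real.sinh_pos_iff.2 (by linarith)
    have hc : 0 < Real.cosh t := Real.cosh_pos t
    have hD : (Real.sinh (2 * t)) ^ 2 - (Real.sinh (2 * l)) ^ 2
        = Real.sinh (2 * (t - l)) * Real.sinh (2 * (t + l)) := by
      have e1 : 2 * (t - l) = 2 * t - 2 * l := by ring
      have e2 : 2 * (t + l) = 2 * t + 2 * l := by ring
      rw [e1, e2, Real.sinh_sub, Real.sinh_add]
      have := Real.cosh_sq (2 * t)
      have := Real.cosh_sq (2 * l)
      nlinarith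
    have hlow : (t - l) * Real.exp (t - l) ≤ Real.sinh (2 * (t - l)) := by
      rw [Real.sinh_two_mul]
      have h1 : t - l ≤ Real.sinh (t - l) := Real.self_le_sinh_iff.2 hu.le
      have h2 : Real.exp (t - l) ≤ 2 * Real.cosh (t - l) := by
        rw [Real.cosh_eq]; have := Real.exp_pos (-(t - l)); linarith
      have := mul_le_mul h1 h2 (Real.exp_pos _).le (by linarith)
      linarith
    have hp : 0 < (t - l) * Real.exp (t - l) := mul_pos hu (Real.exp_pos _)
    rw [hD, Real.sqrt_mul (hp.le.trans hlow), Real.norm_of_nonneg (by positivity), gAux,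
      ← div_eq_mul_inv]
    have hq := Real.sqrt_le_sqrt hlow
    have hq0 := Real.sqrt_pos.2 hp
    have hr0 := Real.sqrt_pos.2 hs2
    rw [div_le_div_iff₀ (mul_pos hc (mul_pos (hq0.trans_le hq) hr0)) hq0]
    calc _ ≤ (K * (Real.cosh t * Real.sqrt (Real.sinh (2 * (t + l))))) *
          Real.sqrt (Real.sinh (2 * (t - l))) :=
          mul_le_mul (h t ht) hq hq0.le (by positivity)
      _ = _ := by ring
  · rw [Set.indicator_of_notMem (show t ∉ Set.Ioi l from ht),
      Set.indicator_of_notMem (show t - l ∉ Set.Ioi (0:ℝ) from fun hh => ht (sub_pos.1 hh))]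
    simp

theorem d0_tendsto_zero :
    Tendsto
      (fun l : ℝ => ∫ t in Set.Ioi l, Real.sinh (2 * l) /
        (Real.cosh t * Real.sqrt ((Real.sinh (2 * t)) ^ 2 - (Real.sinh (2 * l)) ^ 2)))
      (nhdsWithin 0 (Set.Ioi 0)) (nhds 0) ∧
    Tendsto
      (fun l : ℝ => ∫ t in Set.Ioi l, Real.sinh (2 * l) /
        (Real.cosh t * Real.sqrt ((Real.sinh (2 * t)) ^ 2 - (Real.sinh (2 * l)) ^ 2)))
      atTop (nhds 0) := by
  constructor
  · refine squeeze_zero_norm' (a := fun l => Real.sqrt (Real.sinh (2 * l)) *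
      ∫ u in Set.Ioi 0, gAux u) ?_ ?_
    · filter_upwards [self_mem_nhdsWithin] with l hl
      have hl : 0 < l := hl
      refine key_bound l _ hl (Real.sqrt_nonneg _) fun t ht => ?_
      have hs : 0 < Real.sinh (2 * l) := Real.sinh_pos_iff.2 (by linarith)
      have h1 : Real.sqrt (Real.sinh (2 * l)) ≤ Real.sqrt (Real.sinh (2 * (t + l))) :=
        Real.sqrt_le_sqrt (Real.sinh_le_sinh.2 (by linarith))
      have h2 := Real.one_le_cosh t
      have h3 := Real.sqrt_nonneg (Real.sinh (2 * (t + l)))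
      calc Real.sinh (2 * l) = Real.sqrt (Real.sinh (2 * l)) * Real.sqrt (Real.sinh (2 * l)) :=
            (Real.mul_self_sqrt hs.le).symm
        _ ≤ _ := mul_le_mul_of_nonneg_left (by nlinarith) (Real.sqrt_nonneg _)
    · have hc : Continuous (fun l : ℝ => Real.sqrt (Real.sinh (2 * l)) *
          ∫ u in Set.Ioi 0, gAux u) :=
        (Real.continuous_sqrt.comp (Real.continuous_sinh.comp
          (continuous_const.mul continuous_id))).mul continuous_const
      have := hc.tendsto 0
      simp only [mul_zero, Real.sinh_zero, Real.sqrt_zero, zero_mul] at this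
      exact this.mono_left nhdsWithin_le_nhds
  · refine squeeze_zero_norm' (a := fun l => (Real.cosh l)⁻¹ *
      ∫ u in Set.Ioi 0, gAux u) ?_ ?_
    · filter_upwards [eventually_gt_atTop 0] with l hl
      have hcl := Real.cosh_pos l
      refine key_bound l _ hl (inv_pos.2 hcl).le fun t ht => ?_
      have hs : 0 < Real.sinh (2 * l) := Real.sinh_pos_iff.2 (by linarith)
      have h1 : Real.sinh (2 * l) ≤ Real.sqrt (Real.sinh (2 * (t + l))) := by
        apply Real.le_sqrt_of_sq_le
        have h4 : Real.sinh (2 * (2 * l)) ≤ Real.sinh (2 * (t + l)) :=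
          Real.sinh_le_sinh.2 (by linarith)
        rw [Real.sinh_two_mul] at h4
        have := Real.sinh_lt_cosh (2 * l)
        nlinarith
      have h2 : Real.cosh l ≤ Real.cosh t :=
        Real.cosh_le_cosh.2 (by rw [abs_of_pos hl, abs_of_pos (hl.trans ht)]; exact ht.le)
      rw [inv_mul_eq_div, le_div_iff₀ hcl, mul_comm]
      exact mul_le_mul h2 h1 hs.le (Real.cosh_pos t).le
    · have hcosh : Tendsto Real.cosh atTop atTop := by
        refine tendsto_atTop_mono' atTop ?_ (tendsto_id)
        filter_upwards [eventually_ge_atTop 0] with x hx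
        exact (Real.self_le_sinh_iff.2 hx).trans (Real.sinh_lt_cosh x).le
      simpa using (tendsto_inv_atTop_zero.comp hcosh).mul_const (∫ u in Set.Ioi 0, gAux u)
end

section
/- The function h(λ) = ( √5 · cosh λ − cosh(3λ) ) / ( sinh(3λ) − √5 · sinh λ ) is strictly decreasing on the interval (0, ∞). (Note that the denominator sinh(3λ) − √5 · sinh λ is strictly positive for λ > 0, so h is well defined there.) -/
open Real

theorem h_strictAnti :
    (∀ l : ℝ, 0 < l → 0 < Real.sinh (3 * l) - Real.sqrt 5 * Real.sinh l) ∧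
    StrictAntiOn
      (fun l : ℝ => (Real.sqrt 5 * Real.cosh l - Real.cosh (3 * l)) /
        (Real.sinh (3 * l) - Real.sqrt 5 * Real.sinh l))
      (Set.Ioi 0) := by
  have h5 : Real.sqrt 5 ^ 2 = 5 := Real.sq_sqrt (by norm_num)
  have h0 : 0 ≤ Real.sqrt 5 := Real.sqrt_nonneg 5
  have h2 : 2 < Real.sqrt 5 := by nlinarith
  have h3 : Real.sqrt 5 < 3 := by nlinarith
  have hpos : ∀ l : ℝ, 0 < l → 0 < Real.sinh (3 * l) - Real.sqrt 5 * Real.sinh l := by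
    intro l hl
    have hs : 0 < Real.sinh l := Real.sinh_pos_iff.2 hl
    have e : Real.sinh (3 * l) - Real.sqrt 5 * Real.sinh l
        = Real.sinh l * (4 * Real.sinh l ^ 2 + (3 - Real.sqrt 5)) := by
      rw [Real.sinh_three_mul]; ring
    rw [e]
    have : 0 < 3 - Real.sqrt 5 := by linarith
    positivity
  refine ⟨hpos, ?_⟩
  have hd : ∀ l : ℝ, 0 < l → HasDerivAt
      (fun l : ℝ => (Real.sqrt 5 * Real.cosh l - Real.cosh (3 * l)) /
        (Real.sinh (3 * l) - Real.sqrt 5 * Real.sinh l))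
      (((Real.sqrt 5 * Real.sinh l - Real.sinh (3 * l) * (3 * 1)) *
          (Real.sinh (3 * l) - Real.sqrt 5 * Real.sinh l)
        - (Real.sqrt 5 * Real.cosh l - Real.cosh (3 * l)) *
          (Real.cosh (3 * l) * (3 * 1) - Real.sqrt 5 * Real.cosh l)) /
        (Real.sinh (3 * l) - Real.sqrt 5 * Real.sinh l) ^ 2) l := by
    intro l hl
    have i3 : HasDerivAt (fun x : ℝ => 3 * x) (3 * 1) l := (hasDerivAt_id l).const_mul 3
    exact (((Real.hasDerivAt_cosh l).const_mul _).sub i3.cosh).div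
      (i3.sinh.sub ((Real.hasDerivAt_sinh l).const_mul _)) (hpos l hl).ne'
  apply strictAntiOn_of_deriv_neg (convex_Ioi 0)
  · intro l hl
    exact (hd l hl).continuousAt.continuousWithinAt
  · intro l hl
    rw [interior_Ioi] at hl
    rw [(hd l hl).deriv]
    apply div_neg_of_neg_of_pos _ (pow_pos (hpos l hl) 2)
    have q1 := Real.cosh_sq l
    have q3 := Real.cosh_sq (3 * l)
    have q2 : Real.cosh (3 * l) * Real.cosh l - Real.sinh (3 * l) * Real.sinh l
        = 1 + 2 * Real.sinh l ^ 2 := by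
      rw [← Real.cosh_sub, show 3 * l - l = 2 * l by ring, Real.cosh_two_mul, q1]; ring
    have e : (Real.sqrt 5 * Real.sinh l - Real.sinh (3 * l) * (3 * 1)) *
          (Real.sinh (3 * l) - Real.sqrt 5 * Real.sinh l)
        - (Real.sqrt 5 * Real.cosh l - Real.cosh (3 * l)) *
          (Real.cosh (3 * l) * (3 * 1) - Real.sqrt 5 * Real.cosh l)
        = 8 - 4 * Real.sqrt 5 * (1 + 2 * Real.sinh l ^ 2) := by
      linear_combination (-4 * Real.sqrt 5) * q2 + 3 * q3 + Real.sqrt 5 ^ 2 * q1 + h5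
    rw [e]
    nlinarith [mul_nonneg h0 (sq_nonneg (Real.sinh l))]
end

section
/- There exist real numbers Λ₃ and Λ₄ with 0 < Λ₃ < Λ₄ such that: for every λ with 0 < λ ≤ Λ₃ and every t ≥ 0, √5 · cosh(t+λ) − cosh(t+3λ) > 0; and for every λ ≥ Λ₄ and every t ≥ 0, √5 · cosh(t+λ) − cosh(t+3λ) ≤ 0. -/
open Real

theorem phi_sign_thresholds :
    ∃ Λ₃ Λ₄ : ℝ, 0 < Λ₃ ∧ Λ₃ < Λ₄ ∧
      (∀ l : ℝ, 0 < l → l ≤ Λ₃ → ∀ t : ℝ, 0 ≤ t →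
        0 < Real.sqrt 5 * Real.cosh (t + l) - Real.cosh (t + 3 * l)) ∧
      (∀ l : ℝ, Λ₄ ≤ l → ∀ t : ℝ, 0 ≤ t →
        Real.sqrt 5 * Real.cosh (t + l) - Real.cosh (t + 3 * l) ≤ 0) := by
  have h2 : (2 : ℝ) < Real.sqrt 5 := by
    rw [Real.lt_sqrt (by norm_num)]; norm_num
  have h3 : Real.sqrt 5 < (3 : ℝ) := by
    rw [Real.sqrt_lt' (by norm_num)]; norm_num
  refine ⟨Real.log 2 / 2, 5 / 2, ?_, ?_, ?_, ?_⟩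
  · have := Real.log_pos (one_lt_two); linarith
  · have := Real.log_two_lt_d9; linarith
  · intro l hl hl2 t ht
    have hc := Real.cosh_pos (t + l)
    have e1 : Real.exp (2 * l) ≤ 2 := by
      rw [← Real.le_log_iff_exp_le (by norm_num)]; linarith
    have e2 : Real.exp (-(2 * l)) ≤ 1 := by
      rw [Real.exp_le_one_iff]; linarith
    have key : Real.cosh (t + 3 * l) ≤ 2 * Real.cosh (t + l) := by
      rw [Real.cosh_eq, Real.cosh_eq,
        show t + 3 * l = (t + l) + 2 * l by ring,
        show -((t + l) + 2 * l) = -(t + l) + -(2 * l) by ring, Real.exp_add (t + l),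
        Real.exp_add (-(t + l))]
      have p := Real.exp_pos (t + l)
      have q := Real.exp_pos (-(t + l))
      nlinarith
    nlinarith
  · intro l hl t ht
    have hc := Real.cosh_pos (t + l)
    have hs : 0 ≤ Real.sinh (t + l) := Real.sinh_nonneg_iff.2 (by linarith)
    have hs2 : 0 ≤ Real.sinh (2 * l) := Real.sinh_nonneg_iff.2 (by linarith)
    have hc2 : 3 ≤ Real.cosh (2 * l) := by
      rw [Real.cosh_eq]
      have := Real.add_one_le_exp (2 * l)
      have := Real.exp_pos (-(2 * l))
      linarith
    rw [show t + 3 * l = (t + l) + 2 * l by ring, Real.cosh_add (t + l)]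
    have := mul_nonneg hs hs2
    nlinarith
end

section
/- For every real number λ > 0, the function d₀ is differentiable at λ with derivative d₀'(λ) = ∫_0^∞ sinh(t+λ) · ( 5 cosh(t+λ)² − cosh(t+3λ)² ) / ( cosh(t+λ)² · √(sinh(2t)) · √(sinh(2t+4λ)³) ) dt, where d₀(λ) = ∫_λ^∞ sinh(2λ)/( cosh t · √(sinh(2t)² − sinh(2λ)²) ) dt. -/
open Real MeasureTheory

lemma bnd_integrable : IntegrableOn (fun t : ℝ => 1 / √(sinh (2 * t))) (Set.Ioi 0) := by
  have h := integrableOn_rpow_mul_exp_neg_mul_rpow (p := 1) (s := -(1/2)) (b := 1/2)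
    (by norm_num) (by norm_num) (by norm_num)
  refine Integrable.mono' h ?_ ?_
  · have : Measurable (fun t : ℝ => 1 / √(sinh (2 * t))) := by fun_prop
    exact this.aestronglyMeasurable
  · refine (ae_restrict_iff' measurableSet_Ioi).2 (Filter.Eventually.of_forall fun t ht => ?_)
    have ht : 0 < t := ht
    rw [Real.norm_of_nonneg (by positivity)]
    have e1 : t ^ (-(1/2) : ℝ) * exp (-(1/2) * t ^ (1:ℝ)) = 1 / √(t * exp t) := by
      rw [Real.rpow_neg ht.le, ← Real.sqrt_eq_rpow, Real.rpow_one, Real.sqrt_mul ht.le,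
        show -(1/2) * t = -(t/2) by ring, Real.exp_neg, Real.exp_half]
      field_simp
    rw [e1]
    have h1 : t ≤ sinh t := Real.self_le_sinh_iff.2 ht.le
    have h2 : exp t / 2 ≤ cosh t := by
      rw [Real.cosh_eq]; have := exp_pos (-t); linarith
    have h3 : t * exp t ≤ sinh (2 * t) := by
      rw [Real.sinh_two_mul]
      have := mul_le_mul h1 h2 (by positivity) (ht.le.trans h1)
      linarith
    have := exp_pos t
    exact one_div_le_one_div_of_le (by positivity) (Real.sqrt_le_sqrt h3)

/-- The integrand after the shift. -/
noncomputable def FF (m t : ℝ) : ℝ :=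
  sinh (2 * m) / (cosh (t + m) * (√(sinh (2 * t)) * √(sinh (2 * t + 4 * m))))

/-- Its derivative in the parameter. -/
noncomputable def FF' (l t : ℝ) : ℝ :=
  sinh (t + l) * (5 * (cosh (t + l)) ^ 2 - (cosh (t + 3 * l)) ^ 2) /
          ((cosh (t + l)) ^ 2 * √(sinh (2 * t)) * √((sinh (2 * t + 4 * l)) ^ 3))

lemma shift_eq (m : ℝ) : (∫ t in Set.Ioi m, sinh (2 * m) /
        (cosh t * √((sinh (2 * t)) ^ 2 - (sinh (2 * m)) ^ 2))) = ∫ t in Set.Ioi 0, FF m t := by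
  have h := (measurePreserving_add_right (volume : Measure ℝ) m).setIntegral_preimage_emb
    (measurableEmbedding_addRight m) (fun t => sinh (2 * m) /
        (cosh t * √((sinh (2 * t)) ^ 2 - (sinh (2 * m)) ^ 2))) (Set.Ioi m)
  rw [← h]
  have e : (fun x => x + m) ⁻¹' Set.Ioi m = Set.Ioi 0 := by ext; simp
  rw [e]
  refine setIntegral_congr_fun measurableSet_Ioi fun t ht => ?_
  have ht : 0 < t := ht
  have h0 : 0 ≤ sinh (2 * t) := Real.sinh_nonneg_iff.2 (by linarith)
  simp only [FF]
  rw [← Real.sqrt_mul h0]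
  congr 3
  have a1 : 2 * t = 2 * (t + m) - 2 * m := by ring
  have a2 : 2 * t + 4 * m = 2 * (t + m) + 2 * m := by ring
  rw [a2, a1, Real.sinh_add, Real.sinh_sub]
  have c1 := Real.cosh_sq (2 * (t + m))
  have c2 := Real.cosh_sq (2 * m)
  linear_combination (-sinh (2*(t+m))^2) * c2 + (sinh (2*m))^2 * c1

lemma key_id (m t : ℝ) : sinh (2 * m) * sinh (2 * t + 4 * m) =
    cosh (t + 3 * m) ^ 2 - cosh (t + m) ^ 2 := by
  have a1 : 2 * m = (t + 3 * m) - (t + m) := by ring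
  have a2 : 2 * t + 4 * m = (t + 3 * m) + (t + m) := by ring
  rw [a2, a1, Real.sinh_add, Real.sinh_sub]
  have c1 := Real.cosh_sq (t + 3 * m)
  have c2 := Real.cosh_sq (t + m)
  linear_combination (sinh (t + 3 * m)^2 + 1) * c2 - (1 + sinh (t + m) ^2) * c1

lemma FF_deriv (m t : ℝ) (hm : 0 < m) (ht : 0 < t) :
    HasDerivAt (fun x => FF x t) (FF' m t) m := by
  have hs : 0 < sinh (2 * t) := Real.sinh_pos_iff.2 (by linarith)
  have hS : 0 < sinh (2 * t + 4 * m) := Real.sinh_pos_iff.2 (by linarith)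
  have hC := Real.cosh_pos (t + m)
  have d1 : HasDerivAt (fun x : ℝ => sinh (2 * x)) (cosh (2 * m) * 2) m := by
    simpa using ((hasDerivAt_id m).const_mul 2).sinh
  have d2 : HasDerivAt (fun x : ℝ => cosh (t + x)) (sinh (t + m)) m := by
    simpa using ((hasDerivAt_id m).const_add t).cosh
  have d3 : HasDerivAt (fun x : ℝ => sinh (2 * t + 4 * x)) (cosh (2 * t + 4 * m) * 4) m := by
    simpa using (((hasDerivAt_id m).const_mul 4).const_add (2 * t)).sinh
  have d := d1.div (d2.mul ((d3.sqrt hS.ne').const_mul (√(sinh (2 * t))))) (by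
    simp only [Pi.mul_apply]; positivity)
  refine d.congr_deriv ?_
  simp only [Pi.mul_apply, FF']
  have k := key_id m t
  have e3 : √(sinh (2 * t + 4 * m) ^ 3) = √(sinh (2 * t + 4 * m)) ^ 3 := by
    rw [show sinh (2 * t + 4 * m) ^ 3 = (√(sinh (2 * t + 4 * m)) ^ 3) ^ 2 by
      rw [← pow_mul, show 3 * 2 = 2 * 3 by rfl, pow_mul, Real.sq_sqrt hS.le],
      Real.sqrt_sq (by positivity)]
  have k2 : cosh (2 * m) * sinh (2 * t + 4 * m) - sinh (2 * m) * cosh (2 * t + 4 * m)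
      = 2 * sinh (t + m) * cosh (t + m) := by
    rw [← Real.sinh_two_mul, show 2 * (t + m) = (2 * t + 4 * m) - 2 * m by ring, Real.sinh_sub]
    ring
  rw [e3]
  have hq : √(sinh (2 * t + 4 * m)) ^ 2 = sinh (2 * t + 4 * m) := Real.sq_sqrt hS.le
  have hQ : 0 < √(sinh (2 * t + 4 * m)) := Real.sqrt_pos.2 hS
  have hP : 0 < √(sinh (2 * t)) := Real.sqrt_pos.2 hs
  rw [show 5 * cosh (t + m) ^ 2 - cosh (t + 3 * m) ^ 2 =
    4 * cosh (t + m) ^ 2 - sinh (2 * m) * sinh (2 * t + 4 * m) by rw [k]; ring]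
  clear d d3 e3 k
  generalize √(sinh (2 * t + 4 * m)) = Q at *
  generalize √(sinh (2 * t)) = P at *
  generalize sinh (2 * t + 4 * m) = S at *
  generalize cosh (2 * t + 4 * m) = T at *
  subst hq
  field_simp
  linear_combination (4 * cosh (t + m)) * k2

lemma FF'_bound (l m t : ℝ) (hl : 0 < l) (h1 : l / 2 < m) (h2 : m < 3 * l / 2) (ht : 0 < t) :
    ‖FF' m t‖ ≤ ((2 / sinh (l / 2) + sinh (3 * l)) / √(sinh (2 * l))) * (1 / √(sinh (2 * t))) := by
  have hs : 0 < sinh (2 * t) := Real.sinh_pos_iff.2 (by linarith)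
  have hS : 0 < sinh (2 * t + 4 * m) := Real.sinh_pos_iff.2 (by linarith)
  have hC := Real.cosh_pos (t + m)
  have hC1 := Real.one_le_cosh (t + m)
  have hA : 0 < sinh (t + m) := Real.sinh_pos_iff.2 (by linarith)
  have hAC : sinh (t + m) < cosh (t + m) := Real.sinh_lt_cosh _
  have hl2 : 0 < sinh (l / 2) := Real.sinh_pos_iff.2 (by linarith)
  have h2l : 0 < sinh (2 * l) := Real.sinh_pos_iff.2 (by linarith)
  have h2m : 0 < sinh (2 * m) := Real.sinh_pos_iff.2 (by linarith)
  have b1 : sinh (2 * m) ≤ sinh (3 * l) := Real.sinh_le_sinh.2 (by linarith)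
  have b2 : √(sinh (2 * l)) ≤ √(sinh (2 * t + 4 * m)) :=
    Real.sqrt_le_sqrt (Real.sinh_le_sinh.2 (by linarith))
  have b3 : sinh (l / 2) ≤ sinh (t + m) := Real.sinh_le_sinh.2 (by linarith)
  have b4 : 2 * sinh (t + m) * cosh (t + m) ≤ sinh (2 * t + 4 * m) := by
    rw [← Real.sinh_two_mul]; exact Real.sinh_le_sinh.2 (by linarith)
  have e3 : √(sinh (2 * t + 4 * m) ^ 3) = sinh (2 * t + 4 * m) * √(sinh (2 * t + 4 * m)) := by
    rw [pow_succ, Real.sqrt_mul (by positivity), Real.sqrt_sq hS.le]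
  have hQ : 0 < √(sinh (2 * t + 4 * m)) := Real.sqrt_pos.2 hS
  have hP : 0 < √(sinh (2 * t)) := Real.sqrt_pos.2 hs
  have hL : 0 < √(sinh (2 * l)) := Real.sqrt_pos.2 h2l
  unfold FF'
  rw [e3, show 5 * cosh (t + m) ^ 2 - cosh (t + 3 * m) ^ 2 =
    4 * cosh (t + m) ^ 2 - sinh (2 * m) * sinh (2 * t + 4 * m) by rw [key_id]; ring]
  generalize √(sinh (2 * t + 4 * m)) = Q at *
  generalize √(sinh (2 * t)) = P at *
  generalize √(sinh (2 * l)) = L at *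
  generalize sinh (2 * t + 4 * m) = S at *
  generalize sinh (t + m) = A at *
  generalize cosh (t + m) = C at *
  generalize sinh (2 * m) = M at *
  generalize sinh (3 * l) = N at *
  generalize sinh (l / 2) = B at *
  have hN : 0 < N := h2m.trans_le b1
  have eq : A * (4 * C ^ 2 - M * S) / (C ^ 2 * P * (S * Q)) =
      ((A / C) * (4 * (C / S) - M / C)) / Q * (1 / P) := by
    field_simp
  rw [eq, norm_mul, Real.norm_of_nonneg (r := 1 / P) (by positivity)]
  refine mul_le_mul_of_nonneg_right ?_ (by positivity)
  rw [norm_div, Real.norm_of_nonneg hQ.le]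
  refine div_le_div₀ (by positivity) ?_ hL b2
  have c1 : A / C ≤ 1 := (div_le_one hC).2 hAC.le
  have c2 : 4 * (C / S) ≤ 2 / B := by
    rw [← mul_div_assoc, div_le_div_iff₀ hS hl2]
    nlinarith
  have c3 : M / C ≤ N := (div_le_self h2m.le hC1).trans b1
  have c4 : 0 < M / C := by positivity
  have c5 : 0 < C / S := by positivity
  rw [norm_mul, Real.norm_of_nonneg (by positivity)]
  calc A / C * ‖4 * (C / S) - M / C‖ ≤ 1 * (2 / B + N) := by
        refine mul_le_mul c1 ?_ (norm_nonneg _) zero_le_one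
        rw [Real.norm_eq_abs, abs_le]
        constructor <;> linarith
    _ = _ := one_mul _

lemma FF_bound (l t : ℝ) (hl : 0 < l) (ht : 0 < t) :
    ‖FF l t‖ ≤ (sinh (2 * l) / √(sinh (4 * l))) * (1 / √(sinh (2 * t))) := by
  have hs : 0 < sinh (2 * t) := Real.sinh_pos_iff.2 (by linarith)
  have h2l : 0 < sinh (2 * l) := Real.sinh_pos_iff.2 (by linarith)
  have h4l : 0 < sinh (4 * l) := Real.sinh_pos_iff.2 (by linarith)
  have hC1 := Real.one_le_cosh (t + l)
  have b2 : √(sinh (4 * l)) ≤ √(sinh (2 * t + 4 * l)) :=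
    Real.sqrt_le_sqrt (Real.sinh_le_sinh.2 (by linarith))
  have hP : 0 < √(sinh (2 * t)) := Real.sqrt_pos.2 hs
  have hL : 0 < √(sinh (4 * l)) := Real.sqrt_pos.2 h4l
  unfold FF
  rw [Real.norm_of_nonneg (by positivity), div_mul_div_comm, mul_one]
  refine div_le_div_of_nonneg_left h2l.le (by positivity) ?_
  calc √(sinh (4 * l)) * √(sinh (2 * t)) = 1 * (√(sinh (2 * t)) * √(sinh (4 * l))) := by ring
    _ ≤ _ := by gcongr

theorem d0_hasDerivAt (l : ℝ) (hl : 0 < l) :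
    HasDerivAt
      (fun μ : ℝ => ∫ t in Set.Ioi μ, Real.sinh (2 * μ) /
        (Real.cosh t * Real.sqrt ((Real.sinh (2 * t)) ^ 2 - (Real.sinh (2 * μ)) ^ 2)))
      (∫ t in Set.Ioi (0 : ℝ),
        Real.sinh (t + l) * (5 * (Real.cosh (t + l)) ^ 2 - (Real.cosh (t + 3 * l)) ^ 2) /
          ((Real.cosh (t + l)) ^ 2 * Real.sqrt (Real.sinh (2 * t)) *
            Real.sqrt ((Real.sinh (2 * t + 4 * l)) ^ 3)))
      l := by
  simp_rw [shift_eq]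
  have mF : ∀ m, Measurable (FF m) := fun m => by unfold FF; fun_prop
  have mF' : Measurable (FF' l) := by unfold FF'; fun_prop
  have hI : IntegrableOn (FF l) (Set.Ioi 0) := by
    refine Integrable.mono' (bnd_integrable.const_mul (sinh (2 * l) / √(sinh (4 * l))))
      (mF l).aestronglyMeasurable ?_
    exact (ae_restrict_iff' measurableSet_Ioi).2
      (Filter.Eventually.of_forall fun t ht => FF_bound l t hl ht)
  exact (hasDerivAt_integral_of_dominated_loc_of_deriv_le (F := FF) (F' := FF')
    (s := Set.Ioo (l / 2) (3 * l / 2))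
    (Ioo_mem_nhds (by linarith) (by linarith))
    (Filter.Eventually.of_forall fun m => (mF m).aestronglyMeasurable)
    hI mF'.aestronglyMeasurable
    ((ae_restrict_iff' measurableSet_Ioi).2
      (Filter.Eventually.of_forall fun t ht m hm => FF'_bound l m t hl hm.1 hm.2 ht))
    (bnd_integrable.const_mul _)
    ((ae_restrict_iff' measurableSet_Ioi).2
      (Filter.Eventually.of_forall fun t ht m hm =>
        FF_deriv m t (by linarith [hm.1]) ht))).2
end

section
/- For every t ≥ 0 and every λ with 0 < λ < (1/2)·log 5, one has r(t,λ) < 0, where r(t,λ) = 76 sinh(2λ) − 22 sinh(2t) + 29 sinh(2t+4λ) + sinh(2t+8λ) − 26 sinh(4t+6λ) − 6 sinh(4t+10λ) − 25 sinh(6t+8λ) + sinh(6t+12λ). -/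
open Real

/-- Powers of `a ∈ (0,4)`: each is positive and `a^(n+1) ≤ 4 a^n`. -/
lemma pow_step (a : ℝ) (h0 : 0 < a) (h4 : a < 4) (n : ℕ) : a ^ (n + 1) ≤ 4 * a ^ n := by
  have := pow_pos h0 n
  rw [pow_succ]; nlinarith

/-- The polynomial inequality, in `q = exp (2 l)` and `x = exp (2 t)`; expand in `x - 1`, `q - 1`. -/
lemma poly_neg (x q : ℝ) (hx : 1 ≤ x) (hq : 1 < q) (hq5 : q < 5) :
    (-1) * x ^ 0 * q ^ 0 + (25) * x ^ 0 * q ^ 2 + (6) * x ^ 1 * q ^ 1 + (26) * x ^ 1 * q ^ 3 + (-1) * x ^ 2 * q ^ 2 + (-29) * x ^ 2 * q ^ 4 + (22) * x ^ 2 * q ^ 6 + (-76) * x ^ 3 * q ^ 5 + (76) * x ^ 3 * q ^ 7 + (-22) * x ^ 4 * q ^ 6 + (29) * x ^ 4 * q ^ 8 + (1) * x ^ 4 * q ^ 10 + (-26) * x ^ 5 * q ^ 9 + (-6) * x ^ 5 * q ^ 11 + (-25) * x ^ 6 * q ^ 10 + (1) * x ^ 6 * q ^ 12 < 0 := by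
  obtain ⟨a, rfl⟩ : ∃ a, q = 1 + a := ⟨q - 1, by ring⟩
  obtain ⟨u, rfl⟩ : ∃ u, x = 1 + u := ⟨x - 1, by ring⟩
  have h0 : 0 < a := by linarith
  have h4 : a < 4 := by linarith
  have hu : 0 ≤ u := by linarith
  have hp := fun n : ℕ => pow_pos h0 n
  have hs := pow_step a h0 h4
  have s0 := hs 0
  have s1 := hs 1
  have s2 := hs 2
  have s3 := hs 3
  have s4 := hs 4
  have s5 := hs 5
  have s6 := hs 6
  have s7 := hs 7
  have s8 := hs 8
  have s9 := hs 9
  have s10 := hs 10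
  have s11 := hs 11
  have p1 := hp 1
  have p2 := hp 2
  have p3 := hp 3
  have p4 := hp 4
  have p5 := hp 5
  have p6 := hp 6
  have p7 := hp 7
  have p8 := hp 8
  have p9 := hp 9
  have p10 := hp 10
  have p11 := hp 11
  have p12 := hp 12
  norm_num only at s0 s1 s2 s3 s4 s5 s6 s7 s8 s9 s10 s11
  have c0 : (-128) * a ^ 1 + (-704) * a ^ 2 + (-2400) * a ^ 3 + (-5520) * a ^ 4 + (-8160) * a ^ 5 + (-7728) * a ^ 6 + (-4696) * a ^ 7 + (-1780) * a ^ 8 + (-376) * a ^ 9 + (-24) * a ^ 10 + (6) * a ^ 11 + (1) * a ^ 12 < 0 := by linarith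
  have c1 : (-256) * a ^ 0 + (-1920) * a ^ 1 + (-7680) * a ^ 2 + (-20960) * a ^ 3 + (-39728) * a ^ 4 + (-51488) * a ^ 5 + (-45096) * a ^ 6 + (-26192) * a ^ 7 + (-9604) * a ^ 8 + (-1920) * a ^ 9 + (-80) * a ^ 10 + (42) * a ^ 11 + (6) * a ^ 12 ≤ 0 := by linarith
  have c2 : (-640) * a ^ 0 + (-5440) * a ^ 1 + (-22720) * a ^ 2 + (-59592) * a ^ 3 + (-105284) * a ^ 4 + (-127944) * a ^ 5 + (-106832) * a ^ 6 + (-59940) * a ^ 7 + (-21246) * a ^ 8 + (-3950) * a ^ 9 + (-39) * a ^ 10 + (120) * a ^ 11 + (15) * a ^ 12 ≤ 0 := by linarith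
  have c3 : (-768) * a ^ 0 + (-7168) * a ^ 1 + (-30896) * a ^ 2 + (-80224) * a ^ 3 + (-137740) * a ^ 4 + (-162144) * a ^ 5 + (-131548) * a ^ 6 + (-71836) * a ^ 7 + (-24544) * a ^ 8 + (-4120) * a ^ 9 + (164) * a ^ 10 + (180) * a ^ 11 + (20) * a ^ 12 ≤ 0 := by linarith
  have c4 : (-512) * a ^ 0 + (-4960) * a ^ 1 + (-21688) * a ^ 2 + (-56266) * a ^ 3 + (-95695) * a ^ 4 + (-111116) * a ^ 5 + (-88670) * a ^ 6 + (-47348) * a ^ 7 + (-15496) * a ^ 8 + (-2220) * a ^ 9 + (286) * a ^ 10 + (150) * a ^ 11 + (15) * a ^ 12 ≤ 0 := by linarith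
  have c5 : (-176) * a ^ 0 + (-1728) * a ^ 1 + (-7620) * a ^ 2 + (-19854) * a ^ 3 + (-33786) * a ^ 4 + (-39096) * a ^ 5 + (-30912) * a ^ 6 + (-16164) * a ^ 7 + (-5004) * a ^ 8 + (-536) * a ^ 9 + (180) * a ^ 10 + (66) * a ^ 11 + (6) * a ^ 12 ≤ 0 := by linarith
  have c6 : (-24) * a ^ 0 + (-238) * a ^ 1 + (-1059) * a ^ 2 + (-2780) * a ^ 3 + (-4755) * a ^ 4 + (-5508) * a ^ 5 + (-4326) * a ^ 6 + (-2208) * a ^ 7 + (-630) * a ^ 8 + (-30) * a ^ 9 + (41) * a ^ 10 + (12) * a ^ 11 + (1) * a ^ 12 ≤ 0 := by linarith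
  have d1 := mul_nonpos_of_nonneg_of_nonpos (pow_nonneg hu 1) c1
  have d2 := mul_nonpos_of_nonneg_of_nonpos (pow_nonneg hu 2) c2
  have d3 := mul_nonpos_of_nonneg_of_nonpos (pow_nonneg hu 3) c3
  have d4 := mul_nonpos_of_nonneg_of_nonpos (pow_nonneg hu 4) c4
  have d5 := mul_nonpos_of_nonneg_of_nonpos (pow_nonneg hu 5) c5
  have d6 := mul_nonpos_of_nonneg_of_nonpos (pow_nonneg hu 6) c6
  have e := add_neg_of_neg_of_nonpos c0 (add_nonpos d1 (add_nonpos d2 (add_nonpos d3 (add_nonpos d4 (add_nonpos d5 d6)))))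
  refine lt_of_eq_of_lt ?_ e
  ring

theorem r_neg (t l : ℝ) (ht : 0 ≤ t) (hl : 0 < l) (hl' : l < (1 / 2) * Real.log 5) :
    76 * Real.sinh (2 * l) - 22 * Real.sinh (2 * t) + 29 * Real.sinh (2 * t + 4 * l)
      + Real.sinh (2 * t + 8 * l) - 26 * Real.sinh (4 * t + 6 * l)
      - 6 * Real.sinh (4 * t + 10 * l) - 25 * Real.sinh (6 * t + 8 * l)
      + Real.sinh (6 * t + 12 * l) < 0 := by
  have hq : 1 < Real.exp (2 * l) := Real.one_lt_exp_iff.2 (by linarith)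
  have hx : 1 ≤ Real.exp (2 * t) := Real.one_le_exp (by linarith)
  have hq5 : Real.exp (2 * l) < 5 := by
    rw [← Real.lt_log_iff_exp_lt (by norm_num)]; linarith
  have key := poly_neg _ _ hx hq hq5
  have E : ∀ m n : ℕ, Real.sinh (m * (2 * t) + n * (2 * l)) =
      (Real.exp (2 * t) ^ m * Real.exp (2 * l) ^ n
        - (Real.exp (2 * t) ^ m * Real.exp (2 * l) ^ n)⁻¹) / 2 := by
    intro m n
    rw [Real.sinh_eq, Real.exp_neg, Real.exp_add, Real.exp_nat_mul, Real.exp_nat_mul]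
  have E0 : Real.sinh (2 * l) = _ := (congrArg Real.sinh (by push_cast; ring)).trans (E 0 1)
  have E1 : Real.sinh (2 * t) = _ := (congrArg Real.sinh (by push_cast; ring)).trans (E 1 0)
  have E2 : Real.sinh (2 * t + 4 * l) = _ := (congrArg Real.sinh (by push_cast; ring)).trans (E 1 2)
  have E3 : Real.sinh (2 * t + 8 * l) = _ := (congrArg Real.sinh (by push_cast; ring)).trans (E 1 4)
  have E4 : Real.sinh (4 * t + 6 * l) = _ := (congrArg Real.sinh (by push_cast; ring)).trans (E 2 3)
  have E5 : Real.sinh (4 * t + 10 * l) = _ := (congrArg Real.sinh (by push_cast; ring)).trans (E 2 5)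
  have E6 : Real.sinh (6 * t + 8 * l) = _ := (congrArg Real.sinh (by push_cast; ring)).trans (E 3 4)
  have E7 : Real.sinh (6 * t + 12 * l) = _ := (congrArg Real.sinh (by push_cast; ring)).trans (E 3 6)
  rw [E0, E1, E2, E3, E4, E5, E6, E7]
  generalize Real.exp (2 * t) = x at *
  generalize Real.exp (2 * l) = q at *
  have hx0 : 0 < x := by linarith
  have hq0 : 0 < q := by linarith
  have hD : 0 < 2 * (x ^ 3 * q ^ 6) := by positivity
  refine lt_of_eq_of_lt ?_ (div_neg_of_neg_of_pos key hD)
  field_simp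
  ring
end

section
/- There exists a unique real number Λ_d > 0 such that the function d₀ is strictly increasing on (0, Λ_d], strictly decreasing on [Λ_d, ∞), and satisfies d₀(λ) → 0 as λ → 0⁺ and d₀(λ) → 0 as λ → ∞; in particular d₀ attains its maximum over (0, ∞) exactly at Λ_d. Here d₀(λ) = ∫_λ^∞ sinh(2λ)/( cosh t · √(sinh(2t)² − sinh(2λ)²) ) dt. -/
open Real MeasureTheory Filter

/-- The integrand after the substitution `sin θ = cosh 2λ / cosh 2t`, with `a = cosh 2λ`. -/
noncomputable def kF (a θ : ℝ) : ℝ :=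
  √(a ^ 2 - 1) * (√(sin θ) / ((a + sin θ) * √(a - sin θ)))

noncomputable def kF' (a θ : ℝ) : ℝ :=
  (√(a ^ 2 - 1))⁻¹ * (√(sin θ) / √(a - sin θ) * (a / (a + sin θ) - (a ^ 2 - 1) / (a + sin θ) ^ 2
    - (a ^ 2 - 1) / (2 * ((a + sin θ) * (a - sin θ)))))

noncomputable def kG (a θ : ℝ) : ℝ :=
  √(sin θ) / √(a - sin θ) * (2 * sin θ - a)

noncomputable def kW (a θ : ℝ) : ℝ :=
  sin θ * √(sin θ) * cos θ / (a * (a + sin θ) * √(a - sin θ))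

noncomputable def kW' (a θ : ℝ) : ℝ :=
  √(sin θ) / √(a - sin θ) * ((1 / (a * (a + sin θ))) *
    (3 / 2 * cos θ ^ 2 - sin θ ^ 2 - sin θ * cos θ ^ 2 / (a + sin θ)
      + sin θ * cos θ ^ 2 / (2 * (a - sin θ))))

noncomputable def kD (a : ℝ) : ℝ := ∫ θ in (0 : ℝ)..(π / 2), kF a θ

lemma kpos (a θ : ℝ) (ha : 1 < a) : 0 < a + sin θ ∧ 0 < a - sin θ ∧ 0 < √(a - sin θ) ∧
    0 < √(a ^ 2 - 1) ∧ 0 < a := by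
  have h1 := sin_le_one θ
  have h2 := neg_one_le_sin θ
  have h3 : 0 < a - sin θ := by linarith
  exact ⟨by linarith, h3, sqrt_pos.2 h3, sqrt_pos.2 (by nlinarith), by linarith⟩

lemma kF_cont (a : ℝ) (ha : 1 < a) : Continuous (kF a) := by
  unfold kF
  refine continuous_const.mul (Continuous.div (by fun_prop) (by fun_prop) ?_)
  intro θ
  obtain ⟨h1, h2, h3, h4, h5⟩ := kpos a θ ha
  positivity

lemma kF'_cont2 : ContinuousOn (fun p : ℝ × ℝ => kF' p.1 p.2) {p | 1 < p.1} := by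
  unfold kF'
  have H : ∀ p ∈ {p : ℝ × ℝ | 1 < p.1}, _ := fun p hp => kpos p.1 p.2 hp
  refine ContinuousOn.mul (ContinuousOn.inv₀ (by fun_prop) fun p hp => (H p hp).2.2.2.1.ne')
    (ContinuousOn.mul (ContinuousOn.div (by fun_prop) (by fun_prop)
      fun p hp => (H p hp).2.2.1.ne') ?_)
  refine ContinuousOn.sub (ContinuousOn.sub (ContinuousOn.div (by fun_prop) (by fun_prop) ?_)
    (ContinuousOn.div (by fun_prop) (by fun_prop) ?_))
    (ContinuousOn.div (by fun_prop) (by fun_prop) ?_)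
  all_goals
    intro p hp
    obtain ⟨h1, h2, h3, h4, h5⟩ := H p hp
    positivity

lemma kF'_cont (a : ℝ) (ha : 1 < a) : Continuous (kF' a) := by
  have := kF'_cont2.comp (f := fun θ : ℝ => (a, θ)) (s := Set.univ) (by fun_prop)
    (fun θ _ => ha)
  rw [continuousOn_univ] at this
  exact this

lemma kG_cont (a : ℝ) (ha : 1 < a) : Continuous (kG a) := by
  unfold kG
  refine Continuous.mul (Continuous.div (by fun_prop) (by fun_prop) ?_) (by fun_prop)
  intro θ
  exact (kpos a θ ha).2.2.1.ne'

lemma kW_cont (a : ℝ) (ha : 1 < a) : Continuous (kW a) := by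
  unfold kW
  refine (Continuous.div (by fun_prop) (by fun_prop) ?_)
  intro θ
  obtain ⟨h1, h2, h3, h4, h5⟩ := kpos a θ ha
  positivity

lemma kW'_cont (a : ℝ) (ha : 1 < a) : Continuous (kW' a) := by
  unfold kW'
  refine Continuous.mul (Continuous.div (by fun_prop) (by fun_prop) ?_) 
    (Continuous.mul (Continuous.div (by fun_prop) (by fun_prop) ?_) 
    (Continuous.add (Continuous.sub (by fun_prop) (Continuous.div (by fun_prop) (by fun_prop) ?_))
      (Continuous.div (by fun_prop) (by fun_prop) ?_)))
  all_goals
    intro θ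
    obtain ⟨h1, h2, h3, h4, h5⟩ := kpos a θ ha
    positivity

lemma kF_deriv (a θ : ℝ) (ha : 1 < a) : HasDerivAt (fun x => kF x θ) (kF' a θ) a := by
  obtain ⟨h1, h2, h3, h4, h5⟩ := kpos a θ ha
  have e1 : HasDerivAt (fun x : ℝ => √(x ^ 2 - 1)) ((2 * a) / (2 * √(a ^ 2 - 1))) a := by
    have : HasDerivAt (fun x : ℝ => x ^ 2 - 1) (2 * a) a := by
      simpa using ((hasDerivAt_id a).pow 2).sub_const 1
    exact this.sqrt (by nlinarith)
  have e2 : HasDerivAt (fun x : ℝ => √(x - sin θ)) (1 / (2 * √(a - sin θ))) a :=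
    ((hasDerivAt_id a).sub_const (sin θ)).sqrt h2.ne'
  have e3 : HasDerivAt (fun x : ℝ => x + sin θ) 1 a := (hasDerivAt_id a).add_const _
  have e := e1.mul ((hasDerivAt_const a (√(sin θ))).div (e3.mul e2) (by simp only [Pi.mul_apply]; positivity))
  refine e.congr_deriv ?_
  simp only [Pi.mul_apply, Pi.div_apply]
  unfold kF'
  have q1 : √(a ^ 2 - 1) ^ 2 = a ^ 2 - 1 := sq_sqrt (by nlinarith)
  have q2 : √(a - sin θ) ^ 2 = a - sin θ := sq_sqrt h2.le
  set R := √(a ^ 2 - 1)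
  set Q := √(a - sin θ)
  rw [← q1, ← q2]
  field_simp
  ring_nf
  try (rw [show Q ^ 4 = (Q ^ 2) ^ 2 by ring])
  try (rw [q2]; ring)

lemma kD_deriv0 (a : ℝ) (ha : 1 < a) :
    HasDerivAt kD (∫ θ in (0 : ℝ)..(π / 2), kF' a θ) a := by
  have hc : IsCompact (Set.Icc ((1 + a) / 2) (a + 1) ×ˢ Set.Icc (0 : ℝ) (π / 2)) :=
    isCompact_Icc.prod isCompact_Icc
  obtain ⟨C, hC⟩ := hc.exists_bound_of_continuousOn (f := fun p : ℝ × ℝ => kF' p.1 p.2)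
    (kF'_cont2.mono (by
      rintro ⟨x, y⟩ ⟨hx, -⟩
      have := hx.1
      simp only [Set.mem_ofPred_eq] at *
      linarith))
  refine (intervalIntegral.hasDerivAt_integral_of_dominated_loc_of_deriv_le
    (s := Set.Icc ((1 + a) / 2) (a + 1)) (bound := fun _ => C)
    (Icc_mem_nhds (by linarith) (by linarith)) ?_ ?_ ?_ ?_ ?_ ?_).2
  · filter_upwards [lt_mem_nhds ha] with x hx
    exact (kF_cont x hx).aestronglyMeasurable
  · exact (kF_cont a ha).intervalIntegrable _ _
  · exact (kF'_cont a ha).aestronglyMeasurable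
  · refine Eventually.of_forall fun t ht x hx => hC (x, t) ⟨hx, ?_⟩
    rw [Set.uIoc_of_le (by positivity)] at ht
    exact ⟨ht.1.le, ht.2⟩
  · exact intervalIntegrable_const
  · refine Eventually.of_forall fun t ht x hx => kF_deriv x t ?_
    have := hx.1
    linarith

lemma kW_deriv (a θ : ℝ) (ha : 1 < a) (hs : 0 < sin θ) : HasDerivAt (kW a) (kW' a θ) θ := by
  obtain ⟨h1, h2, h3, h4, h5⟩ := kpos a θ ha
  have s1 := hasDerivAt_sin θ
  have c1 := hasDerivAt_cos θ
  have e1 := s1.sqrt hs.ne'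
  have e2 := (s1.const_sub a).sqrt h2.ne'
  have e3 := ((s1.const_add a).const_mul a)
  have e := ((s1.mul e1).mul c1).div (e3.mul e2) (by simp only [Pi.mul_apply]; positivity)
  refine e.congr_deriv ?_
  simp only [Pi.mul_apply, Pi.div_apply]
  unfold kW'
  have p : 0 < √(sin θ) := sqrt_pos.2 hs
  have q1 : √(sin θ) ^ 2 = sin θ := sq_sqrt hs.le
  have q2 : √(a - sin θ) ^ 2 = a - sin θ := sq_sqrt h2.le
  set R := √(sin θ)
  set Q := √(a - sin θ)
  have q3 : a = Q ^ 2 + R ^ 2 := by rw [q1, q2]; ring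
  have h6 : 0 < Q ^ 2 + R ^ 2 + R ^ 2 := by positivity
  have h7 : 0 < Q ^ 2 + R ^ 2 := by positivity
  rw [← q1, q3, show Q ^ 2 + R ^ 2 - R ^ 2 = Q ^ 2 by ring]
  field_simp
  ring

lemma k_identity (a θ : ℝ) (ha : 1 < a) :
    kF' a θ = (√(a ^ 2 - 1))⁻¹ * (1 / (2 * a) * kG a θ + kW' a θ) := by
  obtain ⟨h1, h2, h3, h4, h5⟩ := kpos a θ ha
  unfold kF' kG kW'
  congr 1
  rw [cos_sq']
  rw [show ∀ x y z w : ℝ, z * (x * y) + x * w = x * (z * y + w) by intros; ring]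
  congr 1
  field_simp
  ring

lemma kD_deriv (a : ℝ) (ha : 1 < a) :
    HasDerivAt kD ((√(a ^ 2 - 1))⁻¹ * (1 / (2 * a)) * ∫ θ in (0 : ℝ)..(π / 2), kG a θ) a := by
  refine (kD_deriv0 a ha).congr_deriv ?_
  have hW : ∫ θ in (0 : ℝ)..(π / 2), kW' a θ = 0 := by
    rw [intervalIntegral.integral_eq_sub_of_hasDerivAt_of_le (f := kW a) (by positivity)
      (kW_cont a ha).continuousOn ?_ ((kW'_cont a ha).intervalIntegrable _ _)]
    · simp [kW]
    · intro x hx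
      exact kW_deriv a x ha (sin_pos_of_pos_of_lt_pi hx.1 (by linarith [hx.2, pi_pos]))
  simp_rw [k_identity a _ ha]
  rw [intervalIntegral.integral_const_mul, intervalIntegral.integral_add
    (((kG_cont a ha).const_mul _).intervalIntegrable _ _) ((kW'_cont a ha).intervalIntegrable _ _),
    hW, intervalIntegral.integral_const_mul]
  ring

lemma kG_cross (a b : ℝ) (ha : 1 < a) (hab : a < b)
    (h : ∫ θ in (0 : ℝ)..(π / 2), kG a θ ≤ 0) : ∫ θ in (0 : ℝ)..(π / 2), kG b θ < 0 := by
  have hb : 1 < b := ha.trans hab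
  -- compare with the ratio at `sin θ = a / 2`
  set c : ℝ := √(a / 2) / √(b - a / 2) with hc
  have hc0 : 0 ≤ c := by positivity
  have key : ∫ θ in (0 : ℝ)..(π / 2), kG b θ < ∫ θ in (0 : ℝ)..(π / 2), c * kG a θ := by
    have P : ∀ θ ∈ Set.Icc (0 : ℝ) (π / 2),
        √(sin θ) / √(b - sin θ) * (2 * sin θ - a) ≤ c * kG a θ := by
      intro θ hθ
      obtain ⟨h1, h2, h3, h4, h5⟩ := kpos a θ ha
      obtain ⟨g1, g2, g3, g4, g5⟩ := kpos b θ hb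
      have hd : 0 < b - a / 2 := by linarith
      have hd' : 0 < √(b - a / 2) := sqrt_pos.2 hd
      unfold kG
      have : c * (√(sin θ) / √(a - sin θ) * (2 * sin θ - a)) -
          √(sin θ) / √(b - sin θ) * (2 * sin θ - a) = √(sin θ) / √(a - sin θ) / √(b - sin θ)
          / √(b - a / 2) * ((√(a / 2) * √(b - sin θ) - √(a - sin θ) * √(b - a / 2)) *
            (2 * sin θ - a)) := by
        rw [hc]
        generalize √(b - a / 2) = z at *
        field_simp
      have h0 : 0 ≤ (√(a / 2) * √(b - sin θ) - √(a - sin θ) * √(b - a / 2)) *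
            (2 * sin θ - a) := by
        rw [← sqrt_mul (by positivity), ← sqrt_mul h2.le]
        rcases le_total a (2 * sin θ) with hh | hh
        · refine mul_nonneg (sub_nonneg.2 (sqrt_le_sqrt ?_)) (by linarith)
          nlinarith
        · refine mul_nonneg_of_nonpos_of_nonpos (sub_nonpos.2 (sqrt_le_sqrt ?_)) (by linarith)
          nlinarith
      have : 0 ≤ c * (√(sin θ) / √(a - sin θ) * (2 * sin θ - a)) -
          √(sin θ) / √(b - sin θ) * (2 * sin θ - a) := by rw [this]; positivity
      linarith
    have P2 : ∀ θ, kG b θ = √(sin θ) / √(b - sin θ) * (2 * sin θ - a) -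
        √(sin θ) / √(b - sin θ) * (b - a) := by intro θ; unfold kG; ring
    refine intervalIntegral.integral_lt_integral_of_continuousOn_of_le_of_exists_lt
      (by positivity) (kG_cont b hb).continuousOn ((kG_cont a ha).const_mul c).continuousOn ?_
      ⟨π / 2, ⟨by positivity, le_rfl⟩, ?_⟩
    · intro θ hθ
      have := P θ ⟨hθ.1.le, hθ.2⟩
      have h2 : 0 ≤ √(sin θ) / √(b - sin θ) * (b - a) :=
        mul_nonneg (by positivity) (by linarith)
      rw [P2]; linarith
    · have := P (π / 2) ⟨by positivity, le_rfl⟩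
      have h2 : 0 < √(sin (π / 2)) / √(b - sin (π / 2)) * (b - a) := by
        have := (kpos b (π / 2) hb).2.2.1
        refine mul_pos (div_pos (by simp) this) (by linarith)
      rw [P2]; linarith
  rw [intervalIntegral.integral_const_mul] at key
  nlinarith

lemma kG_two : ∫ θ in (0 : ℝ)..(π / 2), kG 2 θ ≤ 0 := by
  rw [intervalIntegral.integral_of_le (by positivity)]
  refine integral_nonpos fun θ => ?_
  have := sin_le_one θ
  exact mul_nonpos_of_nonneg_of_nonpos (by positivity) (by linarith)

lemma kD_pos (a : ℝ) (ha : 1 < a) : 0 < kD a := by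
  refine intervalIntegral.intervalIntegral_pos_of_pos_on ((kF_cont a ha).intervalIntegrable _ _)
    ?_ (by positivity)
  intro x hx
  obtain ⟨h1, h2, h3, h4, h5⟩ := kpos a x ha
  have := sin_pos_of_pos_of_lt_pi hx.1 (by linarith [hx.2, pi_pos])
  unfold kF
  positivity

lemma kF_bound (a θ : ℝ) (ha : 1 < a) (hs : 0 ≤ sin θ) : ‖kF a θ‖ ≤ √(a + 1) / a := by
  obtain ⟨h1, h2, h3, h4, h5⟩ := kpos a θ ha
  have h0 : 0 ≤ kF a θ := by unfold kF; positivity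
  rw [norm_of_nonneg h0]
  unfold kF
  have hs1 := sin_le_one θ
  have e1 : √(a ^ 2 - 1) = √(a + 1) * √(a - 1) := by
    rw [← sqrt_mul (by linarith)]; congr 1; ring
  have e2 : √(a - 1) ≤ √(a - sin θ) := sqrt_le_sqrt (by linarith)
  have e3 : √(sin θ) ≤ 1 := sqrt_le_one.2 hs1
  rw [e1, ← mul_div_assoc, div_le_div_iff₀ (by positivity) h5]
  calc √(a + 1) * √(a - 1) * √(sin θ) * a ≤ √(a + 1) * √(a - sin θ) * 1 * (a + sin θ) := by
        gcongr; linarith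
    _ = _ := by ring

lemma kD_one : Tendsto kD (nhdsWithin 1 (Set.Ioi 1)) (nhds 0) := by
  have : Tendsto kD (nhdsWithin 1 (Set.Ioi 1)) (nhds (∫ θ in (0 : ℝ)..(π / 2), (0 : ℝ))) := by
    refine intervalIntegral.tendsto_integral_filter_of_dominated_convergence (fun _ => √3) ?_ ?_
      intervalIntegrable_const ?_
    · filter_upwards [self_mem_nhdsWithin] with x hx
      exact (kF_cont x hx).aestronglyMeasurable
    · filter_upwards [self_mem_nhdsWithin, mem_nhdsWithin_of_mem_nhds (gt_mem_nhds one_lt_two)]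
        with x hx hx2
      refine Eventually.of_forall fun t ht => ?_
      rw [Set.uIoc_of_le (by positivity)] at ht
      refine (kF_bound x t hx (sin_nonneg_of_nonneg_of_le_pi ht.1.le
        (by linarith [ht.2, pi_pos]))).trans ?_
      have hx : 1 < x := hx
      refine (div_le_self (by positivity) hx.le).trans (sqrt_le_sqrt (by linarith))
    · have hne : ∀ᵐ x : ℝ, x ≠ π / 2 := by
        simp [ae_iff]
      filter_upwards [hne] with t htne ht
      rw [Set.uIoc_of_le (by positivity)] at ht
      have ht2 : t < π / 2 := lt_of_le_of_ne ht.2 htne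
      have hs0 : 0 ≤ sin t := sin_nonneg_of_nonneg_of_le_pi ht.1.le (by linarith [ht.2, pi_pos])
      have hs1 : sin t < 1 := by
        rw [← sin_pi_div_two]
        exact sin_lt_sin_of_lt_of_le_pi_div_two (by linarith [ht.1, pi_pos]) le_rfl ht2
      have : ContinuousAt (fun a => kF a t) 1 := by
        unfold kF
        refine ContinuousAt.mul (by fun_prop) (ContinuousAt.div (by fun_prop) (by fun_prop) ?_)
        have : 0 < √(1 - sin t) := sqrt_pos.2 (by linarith)
        positivity
      have h2 : kF 1 t = 0 := by simp [kF]
      have h3 := this.tendsto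
      rw [h2] at h3
      exact h3.mono_left nhdsWithin_le_nhds
  simpa using this

lemma kD_top : Tendsto kD atTop (nhds 0) := by
  have hb : ∀ a : ℝ, 1 < a → ‖kD a‖ ≤ √2 * (√a)⁻¹ * (π / 2) := by
    intro a ha
    have := intervalIntegral.norm_integral_le_of_norm_le_const (a := 0) (b := π / 2)
      (f := kF a) (C := √2 * (√a)⁻¹) ?_
    · rw [sub_zero, abs_of_nonneg (by positivity)] at this
      exact this
    · intro t ht
      rw [Set.uIoc_of_le (by positivity)] at ht
      refine (kF_bound a t ha (sin_nonneg_of_nonneg_of_le_pi ht.1.le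
        (by linarith [ht.2, pi_pos]))).trans ?_
      have h1 : √(a + 1) ≤ √2 * √a := by
        rw [← sqrt_mul (by norm_num)]; exact sqrt_le_sqrt (by linarith)
      have h2 : 0 < √a := sqrt_pos.2 (by linarith)
      have h3 : a = √a * √a := (mul_self_sqrt (by linarith)).symm
      calc √(a + 1) / a ≤ √2 * √a / a := by gcongr
        _ = √2 * √a / (√a * √a) := by rw [← h3]
        _ = _ := by field_simp
  refine squeeze_zero_norm' (a := fun a => √2 * (√a)⁻¹ * (π / 2)) ?_ ?_
  · filter_upwards [eventually_gt_atTop 1] with a ha using hb a ha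
  · have := (tendsto_inv_atTop_zero.comp tendsto_sqrt_atTop).const_mul (√2) |>.mul_const (π / 2)
    simpa using this

lemma kD_unimodal : ∃ A : ℝ, 1 < A ∧ StrictMonoOn kD (Set.Ioc 1 A) ∧
    StrictAntiOn kD (Set.Ici A) := by
  set I : ℝ → ℝ := fun a => ∫ θ in (0 : ℝ)..(π / 2), kG a θ with hI
  have hcont : ∀ a, 1 < a → ContinuousAt kD a := fun a ha => (kD_deriv a ha).continuousAt
  have hco : ∀ a, 1 < a → 0 < (√(a ^ 2 - 1))⁻¹ * (1 / (2 * a)) := by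
    intro a ha
    obtain ⟨h1, h2, h3, h4, h5⟩ := kpos a 0 ha
    positivity
  set S : Set ℝ := {a | 1 < a ∧ 0 < I a} with hS
  have hle : ∀ a ∈ S, a ≤ 2 := by
    rintro a ⟨ha, hp⟩
    by_contra hlt
    have := kG_cross 2 a one_lt_two (not_le.1 hlt) kG_two
    exact absurd hp (not_lt.2 this.le)
  have hbdd : BddAbove S := ⟨2, hle⟩
  have hne : S.Nonempty := by
    by_contra hemp
    rw [Set.not_nonempty_iff_eq_empty] at hemp
    have hn : ∀ a, 1 < a → I a ≤ 0 := by
      intro a ha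
      by_contra hc
      have : a ∈ S := ⟨ha, not_le.1 hc⟩
      rw [hemp] at this
      exact this
    have hanti : AntitoneOn kD (Set.Ioi 1) := by
      refine antitoneOn_of_deriv_nonpos (convex_Ioi 1)
        (fun a ha => (hcont a ha).continuousWithinAt) ?_ ?_
      · rw [interior_Ioi]
        exact fun a ha => (kD_deriv a ha).differentiableAt.differentiableWithinAt
      · rw [interior_Ioi]
        intro a ha
        rw [(kD_deriv a ha).deriv]
        exact mul_nonpos_of_nonneg_of_nonpos (hco a ha).le (hn a ha)
    have : kD 2 ≤ 0 := by
      refine ge_of_tendsto kD_one ?_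
      filter_upwards [self_mem_nhdsWithin, mem_nhdsWithin_of_mem_nhds (gt_mem_nhds one_lt_two)]
        with x hx hx2
      exact hanti hx (by simp) hx2.le
    exact absurd (kD_pos 2 one_lt_two) (not_lt.2 this)
  have hA1 : 1 < sSup S := by
    obtain ⟨x, hx⟩ := hne
    exact lt_of_lt_of_le hx.1 (le_csSup hbdd hx)
  refine ⟨sSup S, hA1, ?_, ?_⟩
  · refine strictMonoOn_of_deriv_pos (convex_Ioc _ _)
      (fun a ha => (hcont a ha.1).continuousWithinAt) ?_
    rw [interior_Ioc]
    intro a ha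
    rw [(kD_deriv a ha.1).deriv]
    refine mul_pos (hco a ha.1) ?_
    obtain ⟨b, hb, hab⟩ := exists_lt_of_lt_csSup hne ha.2
    by_contra hc
    exact absurd hb.2 (not_lt.2 (kG_cross a b ha.1 hab (not_lt.1 hc)).le)
  · refine strictAntiOn_of_deriv_neg (convex_Ici _)
      (fun a ha => (hcont a (hA1.trans_le ha)).continuousWithinAt) ?_
    rw [interior_Ici]
    intro a ha
    have ha : sSup S < a := ha
    have ha1 : 1 < a := hA1.trans ha
    rw [(kD_deriv a ha1).deriv]
    refine mul_neg_of_pos_of_neg (hco a ha1) ?_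
    obtain ⟨b, hb1, hb2⟩ := exists_between ha
    refine kG_cross b a (hA1.trans hb1) hb2 ?_
    by_contra hc
    exact absurd (le_csSup hbdd (show b ∈ S from ⟨hA1.trans hb1, not_le.1 hc⟩)) (not_le.2 hb1)

/-- The integral from the statement. -/
noncomputable def kd0 (l : ℝ) : ℝ := ∫ t in Set.Ioi l, Real.sinh (2 * l) /
          (Real.cosh t * Real.sqrt ((Real.sinh (2 * t)) ^ 2 - (Real.sinh (2 * l)) ^ 2))

lemma kd0_eq (l : ℝ) (hl : 0 < l) : kd0 l = (1 / √2) * kD (cosh (2 * l)) := by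
  set a := cosh (2 * l) with ha
  have ha1 : 1 < a := by rw [ha, one_lt_cosh]; positivity
  have ha0 : 0 < a := by linarith
  set f : ℝ → ℝ := fun t => arcsin (a / cosh (2 * t)) with hf
  set f' : ℝ → ℝ := fun t => 1 / √(1 - (a / cosh (2 * t)) ^ 2) *
    (-(a * (2 * sinh (2 * t))) / cosh (2 * t) ^ 2) with hf'
  have hac : ∀ t ∈ Set.Ioi l, a < cosh (2 * t) := by
    intro t ht
    have ht : l < t := ht
    rw [ha, cosh_lt_cosh, abs_of_pos (by positivity), abs_of_pos (by linarith)]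
    linarith
  have hv : ∀ t ∈ Set.Ioi l, 0 < a / cosh (2 * t) ∧ a / cosh (2 * t) < 1 := by
    intro t ht
    have := hac t ht
    have hc := cosh_pos (2 * t)
    exact ⟨by positivity, by rwa [div_lt_one hc]⟩
  have hder : ∀ t ∈ Set.Ioi l, HasDerivWithinAt f (f' t) (Set.Ioi l) t := by
    intro t ht
    obtain ⟨h1, h2⟩ := hv t ht
    have e0 : HasDerivAt (fun t : ℝ => cosh (2 * t)) (2 * sinh (2 * t)) t := by
      have := ((hasDerivAt_id t).const_mul 2).cosh
      simpa [mul_comm] using this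
    have e1 : HasDerivAt (fun t : ℝ => a / cosh (2 * t))
        (-(a * (2 * sinh (2 * t))) / cosh (2 * t) ^ 2) t := by
      have := (hasDerivAt_const t a).div e0 (cosh_pos _).ne'
      refine this.congr_deriv ?_
      ring
    have := (hasDerivAt_arcsin (by linarith : a / cosh (2 * t) ≠ -1) h2.ne).comp t e1
    exact this.hasDerivWithinAt
  have hinj : Set.InjOn f (Set.Ioi l) := by
    intro x hx y hy hxy
    obtain ⟨h1, h2⟩ := hv x hx
    obtain ⟨h3, h4⟩ := hv y hy
    have e := injOn_arcsin ⟨by linarith, h2.le⟩ ⟨by linarith, h4.le⟩ hxy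
    have hx : l < x := hx
    have hy : l < y := hy
    have hcx := cosh_pos (2 * x)
    have hcy := cosh_pos (2 * y)
    rw [div_eq_div_iff hcx.ne' hcy.ne'] at e
    have e2 := mul_left_cancel₀ ha0.ne' e
    have := cosh_injOn (show 2 * y ∈ Set.Ici 0 from by simp; linarith)
      (show 2 * x ∈ Set.Ici 0 from by simp; linarith) e2
    linarith
  have himg : f '' Set.Ioi l = Set.Ioo 0 (π / 2) := by
    ext θ
    constructor
    · rintro ⟨t, ht, rfl⟩
      obtain ⟨h1, h2⟩ := hv t ht
      exact ⟨arcsin_pos.2 h1, arcsin_lt_pi_div_two.2 h2⟩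
    · rintro ⟨h1, h2⟩
      have hs0 : 0 < sin θ := sin_pos_of_pos_of_lt_pi h1 (by linarith [pi_pos])
      have hs1 : sin θ < 1 := by
        rw [← sin_pi_div_two]
        exact sin_lt_sin_of_lt_of_le_pi_div_two (by linarith [pi_pos]) le_rfl h2
      have hq : a < a / sin θ := by rw [lt_div_iff₀ hs0]; nlinarith
      have hq1 : 1 ≤ a / sin θ := by linarith
      refine ⟨arcosh (a / sin θ) / 2, ?_, ?_⟩
      · have h3 : arcosh a < arcosh (a / sin θ) := (arcosh_lt_arcosh ha0 (by linarith)).2 hq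
        rw [ha, arcosh_cosh (by positivity), ← ha] at h3
        show l < _
        linarith
      · simp only [hf]
        rw [show 2 * (arcosh (a / sin θ) / 2) = arcosh (a / sin θ) by ring, cosh_arcosh hq1,
          div_div_cancel₀ ha0.ne']
        exact arcsin_sin (by linarith [pi_pos]) h2.le
  have hcv := integral_image_eq_integral_abs_deriv_smul measurableSet_Ioi hder hinj (kF a)
  rw [himg] at hcv
  unfold kD
  rw [intervalIntegral.integral_of_le (by positivity), integral_Ioc_eq_integral_Ioo, hcv,
    ← integral_const_mul]
  unfold kd0
  refine setIntegral_congr_fun measurableSet_Ioi ?_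
  intro t ht
  obtain ⟨h1, h2⟩ := hv t ht
  have hlt : l < t := ht
  have hct := hac t ht
  have hsl : 0 < sinh (2 * l) := sinh_pos_iff.2 (by positivity)
  have hst : 0 < sinh (2 * t) := sinh_pos_iff.2 (by linarith)
  have hch : 0 < cosh t := cosh_pos t
  have hsh : 0 < sinh t := sinh_pos_iff.2 (by linarith)
  simp only [hf', hf, kF, smul_eq_mul]
  rw [sin_arcsin (by linarith) h2.le]
  have E1 : sinh (2 * t) ^ 2 - sinh (2 * l) ^ 2 = cosh (2 * t) ^ 2 - a ^ 2 := by
    rw [ha, cosh_sq, cosh_sq]; ring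
  have E2 : √(a ^ 2 - 1) = sinh (2 * l) := by
    rw [ha, cosh_sq, add_sub_cancel_right, sqrt_sq hsl.le]
  have E3 : sinh (2 * t) = 2 * sinh t * cosh t := sinh_two_mul t
  have E4 : cosh (2 * t) = 2 * cosh t ^ 2 - 1 := by rw [cosh_two_mul, sinh_sq]; ring
  have E5 : cosh (2 * t) = 2 * sinh t ^ 2 + 1 := by rw [cosh_two_mul, cosh_sq]; ring
  rw [E1, E2, abs_mul, abs_of_nonneg (by positivity : 0 ≤ 1 / √(1 - (a / cosh (2 * t)) ^ 2)),
    neg_div, abs_neg, abs_of_pos (by positivity)]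
  set c := cosh (2 * t) with hc
  have hc0 : 0 < c := cosh_pos _
  have hX : 0 < c ^ 2 - a ^ 2 := by nlinarith
  have E6 : √(1 - (a / c) ^ 2) = √(c ^ 2 - a ^ 2) / c := by
    rw [show 1 - (a / c) ^ 2 = (c ^ 2 - a ^ 2) / c ^ 2 by field_simp, sqrt_div hX.le,
      sqrt_sq hc0.le]
  have E7 : √(a / c) = √a / √c := sqrt_div ha0.le _
  have E8 : √(a - a / c) = √a * (√2 * sinh t) / √c := by
    rw [show a - a / c = a * (2 * sinh t ^ 2) / c by
      field_simp; linarith, sqrt_div (by positivity), sqrt_mul ha0.le, sqrt_mul (by norm_num),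
      sqrt_sq hsh.le]
  have E9 : a + a / c = a * (2 * cosh t ^ 2) / c := by
    field_simp; linarith
  have p1 : 0 < √(c ^ 2 - a ^ 2) := sqrt_pos.2 hX
  have p2 : 0 < √a := sqrt_pos.2 ha0
  have p3 : 0 < √c := sqrt_pos.2 hc0
  have p4 : 0 < √(2 : ℝ) := by positivity
  have p5 : √(2 : ℝ) ^ 2 = 2 := by norm_num
  rw [E6, E7, E8, E9, E3]
  field_simp
  try rw [p5]

theorem kd0_main :
    ∃! Λd : ℝ, 0 < Λd ∧ StrictMonoOn kd0 (Set.Ioc 0 Λd) ∧ StrictAntiOn kd0 (Set.Ici Λd) ∧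
      Tendsto kd0 (nhdsWithin 0 (Set.Ioi 0)) (nhds 0) ∧ Tendsto kd0 atTop (nhds 0) ∧
      (∀ l : ℝ, 0 < l → l ≠ Λd → kd0 l < kd0 Λd) := by
  obtain ⟨A, hA, hmono, hanti⟩ := kD_unimodal
  have hs2 : 0 < 1 / √(2 : ℝ) := by positivity
  set L := arcosh A / 2 with hL
  have hL0 : 0 < L := half_pos (arcosh_pos hA)
  have hLA : cosh (2 * L) = A := by
    rw [hL, mul_div_cancel₀ _ (two_ne_zero), cosh_arcosh hA.le]
  have hch : ∀ x y : ℝ, 0 < x → x < y → cosh (2 * x) < cosh (2 * y) := by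
    intro x y hx hxy
    rw [cosh_lt_cosh, abs_of_pos (by linarith), abs_of_pos (by linarith)]
    linarith
  have hch' : ∀ x y : ℝ, 0 < x → x ≤ y → cosh (2 * x) ≤ cosh (2 * y) := by
    intro x y hx hxy
    rcases hxy.eq_or_lt with rfl | h
    · exact le_rfl
    · exact (hch x y hx h).le
  have hone : ∀ x : ℝ, 0 < x → 1 < cosh (2 * x) := by
    intro x hx; rw [one_lt_cosh]; positivity
  have M : StrictMonoOn kd0 (Set.Ioc 0 L) := by
    intro x hx y hy hxy
    rw [kd0_eq x hx.1, kd0_eq y hy.1]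
    refine mul_lt_mul_of_pos_left (hmono ⟨hone x hx.1, ?_⟩ ⟨hone y hy.1, ?_⟩ (hch x y hx.1 hxy)) hs2
    · rw [← hLA]; exact hch' x L hx.1 hx.2
    · rw [← hLA]; exact hch' y L hy.1 hy.2
  have N : StrictAntiOn kd0 (Set.Ici L) := by
    intro x hx y hy hxy
    have hx : L ≤ x := hx
    have hy : L ≤ y := hy
    rw [kd0_eq x (by linarith), kd0_eq y (by linarith)]
    refine mul_lt_mul_of_pos_left (hanti ?_ ?_ (hch x y (by linarith) hxy)) hs2
    · rw [← hLA]; exact hch' L x hL0 hx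
    · rw [← hLA]; exact hch' L y hL0 hy
  have T0 : Tendsto kd0 (nhdsWithin 0 (Set.Ioi 0)) (nhds 0) := by
    have h1 : Tendsto (fun l : ℝ => cosh (2 * l)) (nhdsWithin 0 (Set.Ioi 0))
        (nhdsWithin 1 (Set.Ioi 1)) := by
      refine tendsto_nhdsWithin_iff.2 ⟨?_, ?_⟩
      · have : Continuous (fun l : ℝ => cosh (2 * l)) := by fun_prop
        have := this.tendsto 0
        simp only [mul_zero, cosh_zero] at this
        exact this.mono_left nhdsWithin_le_nhds
      · filter_upwards [self_mem_nhdsWithin] with x hx using hone x hx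
    have h2 := (kD_one.comp h1).const_mul (1 / √2)
    rw [mul_zero] at h2
    refine h2.congr' ?_
    filter_upwards [self_mem_nhdsWithin] with x hx using (kd0_eq x hx).symm
  have T1 : Tendsto kd0 atTop (nhds 0) := by
    have h1 : Tendsto (fun l : ℝ => cosh (2 * l)) atTop atTop := by
      refine tendsto_atTop_mono' atTop ?_ tendsto_id
      filter_upwards [eventually_gt_atTop 0] with x hx
      have h1 := add_one_le_exp (2 * x)
      have h2 := exp_pos (-(2 * x))
      rw [cosh_eq]
      simp only [id]
      linarith
    have h2 := (kD_top.comp h1).const_mul (1 / √2)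
    rw [mul_zero] at h2
    refine h2.congr' ?_
    filter_upwards [eventually_gt_atTop 0] with x hx using (kd0_eq x hx).symm
  have X : ∀ l : ℝ, 0 < l → l ≠ L → kd0 l < kd0 L := by
    intro l hl hne
    rcases lt_or_gt_of_ne hne with h | h
    · exact M ⟨hl, h.le⟩ ⟨hL0, le_rfl⟩ h
    · exact N (show L ≤ L from le_rfl) (show L ≤ l from h.le) h
  refine ⟨L, ⟨hL0, M, N, T0, T1, X⟩, ?_⟩
  rintro y ⟨hy0, -, -, -, -, hy⟩
  by_contra hne
  exact lt_asymm (X y hy0 hne) (hy L hL0 (Ne.symm hne))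



theorem d0_unique_maximum :
    ∃! Λd : ℝ, 0 < Λd ∧
      StrictMonoOn
        (fun l : ℝ => ∫ t in Set.Ioi l, Real.sinh (2 * l) /
          (Real.cosh t * Real.sqrt ((Real.sinh (2 * t)) ^ 2 - (Real.sinh (2 * l)) ^ 2)))
        (Set.Ioc 0 Λd) ∧
      StrictAntiOn
        (fun l : ℝ => ∫ t in Set.Ioi l, Real.sinh (2 * l) /
          (Real.cosh t * Real.sqrt ((Real.sinh (2 * t)) ^ 2 - (Real.sinh (2 * l)) ^ 2)))
        (Set.Ici Λd) ∧
      Tendsto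
        (fun l : ℝ => ∫ t in Set.Ioi l, Real.sinh (2 * l) /
          (Real.cosh t * Real.sqrt ((Real.sinh (2 * t)) ^ 2 - (Real.sinh (2 * l)) ^ 2)))
        (nhdsWithin 0 (Set.Ioi 0)) (nhds 0) ∧
      Tendsto
        (fun l : ℝ => ∫ t in Set.Ioi l, Real.sinh (2 * l) /
          (Real.cosh t * Real.sqrt ((Real.sinh (2 * t)) ^ 2 - (Real.sinh (2 * l)) ^ 2)))
        atTop (nhds 0) ∧
      (∀ l : ℝ, 0 < l → l ≠ Λd →
        (∫ t in Set.Ioi l, Real.sinh (2 * l) /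
          (Real.cosh t * Real.sqrt ((Real.sinh (2 * t)) ^ 2 - (Real.sinh (2 * l)) ^ 2)))
        <
        (∫ t in Set.Ioi Λd, Real.sinh (2 * Λd) /
          (Real.cosh t * Real.sqrt ((Real.sinh (2 * t)) ^ 2 - (Real.sinh (2 * Λd)) ^ 2)))) := by
  exact kd0_main
end
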